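/- Let q = p^r with p > 3 prime and q > 9887, and let E be an elliptic curve defined over F_q with j-invariant j(E) = 0 and with an even number of F_q-rational points. If r is even or p ≡ 1 (mod 3), then the 3-elliptic code and the 6-elliptic code associated to E are non-extendable. -/

import Mathlib

set_option linter.unusedSectionVars false

namespace NMDS

open WeierstrassCurve

variable {F : Type} [Field F] [Fintype F] [DecidableEq F]

/-- `ψ_i(X,Y)`: `Y^s` if `i = 3s` (`s ≥ 1`), `X·Y^s` if `i = 3s+2` (`s ≥ 0`),
`X²·Y^s` if `i = 3s+4` (`s ≥ 0`). -/
def psi (i : ℕ) (X Y : F) : F :=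
  if i % 3 = 0 then Y ^ (i / 3)
  else if i % 3 = 2 then X * Y ^ (i / 3)
  else X ^ 2 * Y ^ ((i - 4) / 3)

/-- The coordinate vector of `φ_k(P)`: `(1, ψ₂(P), …, ψ_k(P))` for an affine point `P`,
and `(0, …, 0, 1)` for the point at infinity. -/
def phiVec (W : WeierstrassCurve F) (k : ℕ) : W.toAffine.Point → (Fin k → F)
  | .zero => fun j => if (j : ℕ) = k - 1 then 1 else 0
  | .some (x := x) (y := y) _ => fun j => if (j : ℕ) = 0 then 1 else psi ((j : ℕ) + 1) x y

lemma phiVec_ne_zero (W : WeierstrassCurve F) {k : ℕ} (hk : 0 < k)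
    (P : W.toAffine.Point) : phiVec W k P ≠ 0 := by
  cases P with
  | zero =>
    intro h
    have := congrFun h ⟨k - 1, by omega⟩
    simp [phiVec] at this
  | some h' =>
    intro h
    have := congrFun h ⟨0, hk⟩
    simp [phiVec] at this

/-- The image of a rational point of `E` in `P^{k-1}(F_q)` under `φ_k`. -/
noncomputable def phiProj (W : WeierstrassCurve F) {k : ℕ} (hk : 0 < k)
    (P : W.toAffine.Point) : Projectivization F (Fin k → F) :=
  Projectivization.mk F (phiVec W k P) (phiVec_ne_zero W hk P)

/-- The `k`-elliptic code associated to `E`, relative to an enumeration `e` of the `n`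
rational points of `E`: the span of the rows of the `k × n` matrix whose `j`-th column
is `φ_k(P_j)`. -/
def ellipticCode (W : WeierstrassCurve F) (k : ℕ) {n : ℕ}
    (e : Fin n ≃ W.toAffine.Point) : Submodule F (Fin n → F) :=
  Submodule.span F (Set.range fun i : Fin k => fun j : Fin n => phiVec W k (e j) i)

/-- The minimum distance (= minimum weight) of a linear code. -/
noncomputable def minDist {n : ℕ} (C : Submodule F (Fin n → F)) : ℕ :=
  sInf {d | ∃ x ∈ C, x ≠ 0 ∧ hammingNorm x = d}

/-- The standard inner product with `y` as a linear map. -/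
def dotLin {n : ℕ} (y : Fin n → F) : (Fin n → F) →ₗ[F] F where
  toFun x := ∑ i, x i * y i
  map_add' a b := by simp [add_mul, Finset.sum_add_distrib]
  map_smul' c a := by simp [Finset.mul_sum, mul_assoc]

/-- The dual code: all vectors orthogonal to every codeword. -/
def dualCode {n : ℕ} (C : Submodule F (Fin n → F)) : Submodule F (Fin n → F) :=
  ⨅ y ∈ C, LinearMap.ker (dotLin y)

/-- The Singleton defect `s(C) = n - k + 1 - d` of a code of length `n`. -/
noncomputable def singletonDefect {n : ℕ} (C : Submodule F (Fin n → F)) : ℤ :=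
  (n : ℤ) + 1 - Module.finrank F C - minDist C

/-- A code is MDS if its Singleton defect is zero. -/
noncomputable def IsMDS {n : ℕ} (C : Submodule F (Fin n → F)) : Prop :=
  singletonDefect C = 0

/-- A code is near-MDS if both it and its dual have Singleton defect one. -/
noncomputable def IsNMDS {n : ℕ} (C : Submodule F (Fin n → F)) : Prop :=
  singletonDefect C = 1 ∧ singletonDefect (dualCode C) = 1

/-- An `[n,k,d]_q` code `C` is `h`-extendable if there is an `[n+h,k,d+h]_q` code `C'`
whose projection on the first `n` coordinates is `C`. -/
noncomputable def IsHExtendable {n : ℕ} (h : ℕ) (C : Submodule F (Fin n → F)) : Prop :=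
  ∃ C' : Submodule F (Fin (n + h) → F),
    Module.finrank F C' = Module.finrank F C ∧
    minDist C' = minDist C + h ∧
    Submodule.map (LinearMap.funLeft F F (Fin.castAdd h)) C' = C

/-- The point `p` of `P^{k-1}(F_q)` lies on the hyperplane with coefficient vector `a`. -/
def OnHyp {k : ℕ} (a : Fin k → F) (p : Projectivization F (Fin k → F)) : Prop :=
  ∑ i, a i * p.rep i = 0

/-- An `(·; k, k-2)`-set in `P^{k-1}(F_q)`: no `k+1` of its points lie on a common hyperplane,
i.e. every hyperplane contains at most `k` of its points. -/
def IsArcSet (k : ℕ) (S : Set (Projectivization F (Fin k → F))) : Prop :=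
  ∀ a : Fin k → F, a ≠ 0 → Set.ncard {p ∈ S | OnHyp a p} ≤ k

/-- A complete `(·; k, k-2)`-set: maximal with respect to set-theoretical inclusion. -/
def IsCompleteArcSet (k : ℕ) (S : Set (Projectivization F (Fin k → F))) : Prop :=
  IsArcSet k S ∧ ∀ T, IsArcSet k T → S ⊆ T → T = S

/-- Evaluation of the homogeneous cubic of a Weierstrass curve:
`Y²Z + a₁XYZ + a₃YZ² - X³ - a₂X²Z - a₄XZ² - a₆Z³`. -/
def cubicEval {R : Type*} [CommRing R] (W : WeierstrassCurve R) (x y z : R) : R :=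
  y ^ 2 * z + W.a₁ * x * y * z + W.a₃ * y * z ^ 2
    - (x ^ 3 + W.a₂ * x ^ 2 * z + W.a₄ * x * z ^ 2 + W.a₆ * z ^ 3)

/-- The gradient of the homogeneous cubic of a Weierstrass curve. -/
def gradEval {R : Type*} [CommRing R] (W : WeierstrassCurve R) (x y z : R) : Fin 3 → R :=
  ![W.a₁ * y * z - (3 * x ^ 2 + 2 * W.a₂ * x * z + W.a₄ * z ^ 2),
    2 * y * z + W.a₁ * x * z + W.a₃ * z ^ 2,
    y ^ 2 + W.a₁ * x * y + 2 * W.a₃ * y * z - (W.a₂ * x ^ 2 + 2 * W.a₄ * x * z + 3 * W.a₆ * z ^ 2)]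

/-- The point `p` of `P²(F_q)` lies on the plane cubic `E`. -/
def OnCurve (W : WeierstrassCurve F) (p : Projectivization F (Fin 3 → F)) : Prop :=
  cubicEval W (p.rep 0) (p.rep 1) (p.rep 2) = 0

/-- A line of `P²(F_q)`, given by its coefficient vector `l`, is a tangent of `E`:
it touches the curve at some point (over the algebraic closure) with multiplicity at
least two, i.e. it is the tangent line of the cubic at a contact point. -/
def IsTangentLine (W : WeierstrassCurve F) (l : Fin 3 → F) : Prop :=
  ∃ v : Fin 3 → AlgebraicClosure F, v ≠ 0 ∧
    cubicEval (W.baseChange (AlgebraicClosure F)) (v 0) (v 1) (v 2) = 0 ∧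
    (∑ i, algebraMap F (AlgebraicClosure F) (l i) * v i) = 0 ∧
    ∃ t : AlgebraicClosure F, t ≠ 0 ∧
      gradEval (W.baseChange (AlgebraicClosure F)) (v 0) (v 1) (v 2) =
        t • fun i => algebraMap F (AlgebraicClosure F) (l i)

/-- A line of `P²(F_q)` intersects `E` in three distinct `F_q`-rational points. -/
def IsThreeSecant (W : WeierstrassCurve F) (l : Fin 3 → F) : Prop :=
  ∃ u v w : Projectivization F (Fin 3 → F), u ≠ v ∧ u ≠ w ∧ v ≠ w ∧
    OnCurve W u ∧ OnCurve W v ∧ OnCurve W w ∧ OnHyp l u ∧ OnHyp l v ∧ OnHyp l w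


section

open Polynomial Finset Matrix

/-- Taylor expansion to fourth order with degree control. -/
lemma exists_taylor_expansion {F : Type*} [Field F] (f h : F[X]) {d : ℕ} (hd : f.natDegree ≤ d) :
    ∃ f₁ f₂ f₃ r : F[X], f₁.natDegree ≤ d - 1 ∧ f₂.natDegree ≤ d - 2 ∧ f₃.natDegree ≤ d - 3 ∧
      f.comp (X + h) = f + f₁ * h + f₂ * h ^ 2 + f₃ * h ^ 3 + h ^ 4 * r := by
  refine ⟨hasseDeriv 1 f, hasseDeriv 2 f, hasseDeriv 3 f,
    (((taylor X (f.map C)).divX.divX.divX.divX).eval h), ?_, ?_, ?_, ?_⟩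
  · exact (natDegree_hasseDeriv_le f 1).trans (by omega)
  · exact (natDegree_hasseDeriv_le f 2).trans (by omega)
  · exact (natDegree_hasseDeriv_le f 3).trans (by omega)
  · have key : ∀ i, (taylor X (f.map C)).coeff i = hasseDeriv i f := by
      intro i
      rw [taylor_coeff]
      have : hasseDeriv i (f.map C) = (hasseDeriv i f).map C := by
        ext1 n
        simp [hasseDeriv_coeff]
      rw [this, eval_map, eval₂_C_X]
    have h1 : (taylor X (f.map C)).eval h = f.comp (X + h) := by
      rw [taylor_eval, eval_map, Polynomial.comp, add_comm]
    rw [← h1]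
    set T := taylor X (f.map C) with hT
    have e : ∀ p : F[X][X], p.eval h = p.divX.eval h * h + p.coeff 0 := by
      intro p
      conv_lhs => rw [← divX_mul_X_add p]
      simp
    rw [e T, e T.divX, e T.divX.divX, e T.divX.divX.divX]
    simp only [coeff_divX, key, hasseDeriv_zero, zero_add, LinearMap.id_apply]
    norm_num
    ring

lemma four_mul_card_nonsquare_le {F : Type*} [Field F] [Fintype F] [DecidableEq F]
    (h2 : (2 : F) ≠ 0) (f : F[X])
    (hf : f.natDegree ≤ 6) (a₀ : F) (h0 : f.eval a₀ ≠ 0) (hsq : IsSquare (f.eval a₀)) :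
    4 * (Finset.univ.filter fun a => ¬ IsSquare (f.eval a)).card ≤ 3 * Fintype.card F + 15 := by
  classical
  set q := Fintype.card F with hq
  have hF : ringChar F ≠ 2 := by
    intro h
    apply h2
    have := ringChar.Nat.cast_ringChar (R := F)
    rw [h] at this
    exact_mod_cast this
  have hodd : q % 2 = 1 := FiniteField.odd_card_of_char_ne_two hF
  have hq2 : 2 * (q / 2) + 1 = q := by omega
  set h : F[X] := X ^ q - X with hh
  set g : F[X] := f ^ (q / 2) with hg
  obtain ⟨f₁, f₂, f₃, r, d1, d2, d3, hexp⟩ := exists_taylor_expansion f h hf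
  have hcomp : f.comp (X + h) = f * g ^ 2 := by
    have : X + h = X ^ q := by rw [hh]; ring
    rw [this, ← expand_eq_comp_X_pow, FiniteField.expand_card, hg, ← hq, ← pow_mul, ← pow_succ',
      mul_comm (q / 2) 2, hq2]
  rw [hcomp] at hexp
  set A : F[X] := 8 * f ^ 2 * f₃ - 4 * f * f₁ * f₂ + f₁ ^ 3 with hA
  set B : F[X] := 2 * f * (4 * f * f₂ - f₁ ^ 2) with hB
  set T : F[X] := 16 * f ^ 3 + 8 * f ^ 2 * f₁ * h + B * h ^ 2 + A * h ^ 3 with hT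
  set P : F[X] := T + 16 * f ^ 3 * g with hP
  have hdvd : h ^ 4 ∣ (T - 16 * f ^ 3 * g) * P := by
    have : (T - 16 * f ^ 3 * g) * P = T ^ 2 - 256 * f ^ 5 * (f * g ^ 2) := by rw [hP]; ring
    rw [this, hexp]
    exact ⟨16 * f ^ 2 * f₁ * A + B ^ 2 + 2 * A * B * h + A ^ 2 * h ^ 2 - 256 * f ^ 5 * r, by
      rw [hT, hA, hB]; ring⟩
  have hha : ∀ a : F, h.eval a = 0 := fun a => by simp [hh, hq, FiniteField.pow_card]
  have hTa : ∀ a : F, T.eval a = 16 * f.eval a ^ 3 := fun a => by simp [hT, hha]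
  have hga : ∀ a : F, g.eval a = f.eval a ^ (q / 2) := fun a => by simp [hg]
  have h32 : (32 : F) ≠ 0 := by
    have : (32 : F) = 2 ^ 5 := by norm_num
    rw [this]; exact pow_ne_zero _ h2
  have hP0 : P ≠ 0 := by
    intro h
    have e1 : P.eval a₀ = 32 * f.eval a₀ ^ 3 := by
      rw [hP, eval_add, hTa, eval_mul, hga, (FiniteField.isSquare_iff hF h0).1 hsq]
      simp; ring
    rw [h, eval_zero] at e1
    exact mul_ne_zero h32 (pow_ne_zero _ h0) e1.symm
  set N := Finset.univ.filter fun a => ¬ IsSquare (f.eval a) with hN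
  have hprod : (∏ a ∈ N, (X - C a) ^ 4) ∣ P := by
    apply Finset.prod_dvd_of_coprime
    · intro a _ b _ hab
      exact (IsCoprime.pow (isCoprime_X_sub_C_of_isUnit_sub (sub_ne_zero.2 hab).isUnit))
    · intro a ha
      have hna : ¬ IsSquare (f.eval a) := by simpa [hN] using ha
      have hfa : f.eval a ≠ 0 := fun h => hna (by rw [h]; exact IsSquare.zero)
      have hd : (X - C a) ^ 4 ∣ (T - 16 * f ^ 3 * g) * P :=
        (pow_dvd_pow_of_dvd (dvd_iff_isRoot.2 (hha a)) 4).trans hdvd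
      refine IsCoprime.dvd_of_dvd_mul_left (IsCoprime.pow_left ?_) hd
      rw [(irreducible_X_sub_C a).coprime_iff_not_dvd, dvd_iff_isRoot, IsRoot.def]
      have hm : f.eval a ^ (q / 2) = -1 :=
        (FiniteField.pow_dichotomy hF hfa).resolve_left
          fun h => hna ((FiniteField.isSquare_iff hF hfa).2 h)
      have : (T - 16 * f ^ 3 * g).eval a = 32 * f.eval a ^ 3 := by
        rw [eval_sub, hTa, eval_mul, hga, hm]
        simp; ring
      rw [this]
      exact mul_ne_zero h32 (pow_ne_zero _ hfa)
  have hdeg := natDegree_le_of_dvd hprod hP0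
  have hdl : (∏ a ∈ N, (X - C a) ^ 4).natDegree = 4 * N.card := by
    rw [natDegree_prod _ _ fun a _ => pow_ne_zero _ (X_sub_C_ne_zero a)]
    simp [mul_comm]
  rw [hdl] at hdeg
  refine hdeg.trans ?_
  have hq1 : 1 < q := Fintype.one_lt_card
  have hhd : h.natDegree ≤ q := by
    rw [hh]; compute_degree; omega
  have dk : ∀ (k m : ℕ) (p : F[X]), p.natDegree ≤ m → (p ^ k).natDegree ≤ k * m := fun k m p hp =>
    natDegree_pow_le.trans (Nat.mul_le_mul_left k hp)
  have dm : ∀ (m k : ℕ) (p s : F[X]), p.natDegree ≤ m → s.natDegree ≤ k →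
      (p * s).natDegree ≤ m + k := fun m k p s hp hs => natDegree_mul_le_of_le hp hs
  have dn : ∀ n : ℕ, ((n : F[X])).natDegree ≤ 0 := fun n => by simp
  have dA : A.natDegree ≤ 15 := by
    rw [hA]
    refine natDegree_add_le_of_degree_le ((natDegree_sub_le _ _).trans (max_le ?_ ?_)) (dk 3 5 _ d1)
    · exact dm 12 3 _ _ (dm 0 12 _ _ (dn 8) (dk 2 6 _ hf)) d3
    · exact dm 11 4 _ _ (dm 6 5 _ _ (dm 0 6 _ _ (dn 4) hf) d1) d2
  have dB : B.natDegree ≤ 16 := by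
    rw [hB]
    refine dm 6 10 _ _ (dm 0 6 _ _ (dn 2) hf) ((natDegree_sub_le _ _).trans (max_le ?_ (dk 2 5 _ d1)))
    exact dm 6 4 _ _ (dm 0 6 _ _ (dn 4) hf) d2
  rw [hP, hT]
  refine natDegree_add_le_of_degree_le (natDegree_add_le_of_degree_le
    (natDegree_add_le_of_degree_le (natDegree_add_le_of_degree_le ?_ ?_) ?_) ?_) ?_
  · exact (dm 0 18 _ _ (dn 16) (dk 3 6 _ hf)).trans (by omega)
  · exact (dm 17 q _ _ (dm 12 5 _ _ (dm 0 12 _ _ (dn 8) (dk 2 6 _ hf)) d1) hhd).trans (by omega)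
  · exact (dm 16 (2 * q) _ _ dB (dk 2 q _ hhd)).trans (by omega)
  · exact (dm 15 (3 * q) _ _ dA (dk 3 q _ hhd)).trans (by omega)
  · exact (dm 18 (q / 2 * 6) _ _ (dm 0 18 _ _ (dn 16) (dk 3 6 _ hf)) (dk _ 6 _ hf)).trans (by omega)


lemma sum_quadraticChar_mul_shift (hF : ringChar F ≠ 2) {u v : F} (huv : u ≠ v) :
    ∑ b : F, quadraticChar F (u + b) * quadraticChar F (v + b) = -1 := by
  have hc : v - u ≠ 0 := sub_ne_zero.2 huv.symm
  have e1 : ∑ b : F, quadraticChar F (u + b) * quadraticChar F (v + b)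
      = ∑ b : F, quadraticChar F b * quadraticChar F (b + (v - u)) := by
    refine Fintype.sum_equiv (Equiv.addLeft u) _ _ fun b => ?_
    simp only [Equiv.coe_addLeft]
    congr 2; ring
  have e2 : ∑ b : F, quadraticChar F b * quadraticChar F (b + (v - u))
      = ∑ b : F, (quadraticChar F (1 + (v - u) * b⁻¹) - if b = 0 then 1 else 0) := by
    refine Finset.sum_congr rfl fun b _ => ?_
    by_cases hb : b = 0
    · simp [hb]
    · rw [if_neg hb, sub_zero]
      have : b + (v - u) = b * (1 + (v - u) * b⁻¹) := by field_simp
      rw [this, map_mul, ← mul_assoc, ← sq, quadraticChar_sq_one hb, one_mul]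
  have e3 : ∑ b : F, quadraticChar F (1 + (v - u) * b⁻¹) = ∑ b : F, quadraticChar F b := by
    refine Fintype.sum_equiv (((Equiv.inv F).trans (Equiv.mulLeft₀ _ hc)).trans (Equiv.addLeft 1))
      _ _ fun b => ?_
    simp
  rw [e1, e2, Finset.sum_sub_distrib, e3, quadraticChar_sum_zero hF]
  simp

lemma card_cube_eq_le (c : F) : (univ.filter fun y : F => y ^ 3 = c).card ≤ 3 := by
  have : (univ.filter fun y : F => y ^ 3 = c) ⊆ (Polynomial.nthRoots 3 c).toFinset := by
    intro y hy
    simpa [Polynomial.mem_nthRoots] using hy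
  exact (card_le_card this).trans
    ((Multiset.toFinset_card_le _).trans (Polynomial.card_nthRoots 3 c))

/-- The second moment over the family `y² = x³ + b` of the character sum. -/
lemma sum_sq_charSum_le (hF : ringChar F ≠ 2) :
    ∑ b : F, (∑ x : F, quadraticChar F (x ^ 3 + b)) ^ 2 ≤ 3 * (Fintype.card F : ℤ) ^ 2 := by
  have e1 : ∑ b : F, (∑ x : F, quadraticChar F (x ^ 3 + b)) ^ 2
      = ∑ x : F, ∑ y : F, ∑ b : F, quadraticChar F (x ^ 3 + b) * quadraticChar F (y ^ 3 + b) := by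
    simp_rw [sq, Finset.sum_mul_sum]
    rw [Finset.sum_comm]
    exact Finset.sum_congr rfl fun x _ => Finset.sum_comm
  have e2 : ∀ x y : F, ∑ b : F, quadraticChar F (x ^ 3 + b) * quadraticChar F (y ^ 3 + b)
      ≤ if y ^ 3 = x ^ 3 then (Fintype.card F : ℤ) else 0 := by
    intro x y
    split_ifs with h
    · rw [h]
      calc _ ≤ ∑ b : F, (1 : ℤ) := by
            refine Finset.sum_le_sum fun b _ => ?_
            by_cases hb : x ^ 3 + b = 0
            · simp [hb]
            · rw [← sq, quadraticChar_sq_one hb]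
        _ = _ := by simp
    · rw [sum_quadraticChar_mul_shift hF (Ne.symm h)]; norm_num
  rw [e1]
  calc _ ≤ ∑ x : F, ∑ y : F, (if y ^ 3 = x ^ 3 then (Fintype.card F : ℤ) else 0) :=
        Finset.sum_le_sum fun x _ => Finset.sum_le_sum fun y _ => e2 x y
    _ ≤ ∑ x : F, 3 * (Fintype.card F : ℤ) := by
        refine Finset.sum_le_sum fun x _ => ?_
        rw [← Finset.sum_filter, Finset.sum_const, nsmul_eq_mul]
        exact mul_le_mul_of_nonneg_right (by exact_mod_cast card_cube_eq_le (x ^ 3)) (by positivity)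
    _ = _ := by simp; ring

lemma charSum_sq_scale (b : F) {c : F} (hc : c ≠ 0) :
    (∑ x : F, quadraticChar F (x ^ 3 + b * c ^ 3)) ^ 2
      = (∑ x : F, quadraticChar F (x ^ 3 + b)) ^ 2 := by
  have : ∑ x : F, quadraticChar F (x ^ 3 + b * c ^ 3)
      = quadraticChar F (c ^ 3) * ∑ x : F, quadraticChar F (x ^ 3 + b) := by
    rw [Finset.mul_sum]
    refine (Fintype.sum_equiv (Equiv.mulLeft₀ c hc) _ _ fun x => ?_).symm
    rw [← map_mul]
    simp only [Equiv.mulLeft₀_apply]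
    congr 1; ring
  rw [this, mul_pow, quadraticChar_sq_one (pow_ne_zero 3 hc), one_mul]

lemma charSum_sq_le (hF : ringChar F ≠ 2) {b : F} (hb : b ≠ 0) :
    ((Fintype.card F : ℤ) - 1) * (∑ x : F, quadraticChar F (x ^ 3 + b)) ^ 2
      ≤ 9 * (Fintype.card F : ℤ) ^ 2 := by
  set s : F → ℤ := fun b => (∑ x : F, quadraticChar F (x ^ 3 + b)) ^ 2 with hs
  have h0 : ∀ c, 0 ≤ s c := fun c => sq_nonneg _
  have e1 : ((Fintype.card F : ℤ) - 1) * s b = ∑ c ∈ univ.erase (0 : F), s (b * c ^ 3) := by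
    rw [Finset.sum_congr rfl fun c hc => charSum_sq_scale b (Finset.ne_of_mem_erase hc)]
    rw [Finset.sum_const, Finset.card_erase_of_mem (mem_univ _), card_univ, nsmul_eq_mul,
      Nat.cast_sub Fintype.card_pos, Nat.cast_one]
  have e2 : ∑ c ∈ univ.erase (0 : F), s (b * c ^ 3) ≤ ∑ d : F, 3 * s d := by
    rw [← Finset.sum_fiberwise (univ.erase (0 : F)) (fun c => b * c ^ 3)]
    refine Finset.sum_le_sum fun d _ => ?_
    rw [Finset.sum_congr rfl fun c hc => congrArg s (mem_filter.1 hc).2,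
      Finset.sum_const, nsmul_eq_mul]
    refine mul_le_mul_of_nonneg_right ?_ (h0 d)
    have : (filter (fun c => b * c ^ 3 = d) (univ.erase 0)) ⊆ univ.filter fun y => y ^ 3 = d / b := by
      intro c hc
      simp only [mem_filter, mem_univ, true_and] at hc ⊢
      rw [← hc.2]; field_simp
    exact_mod_cast (card_le_card this).trans (card_cube_eq_le _)
  rw [← Finset.mul_sum] at e2
  have := sum_sq_charSum_le hF
  change _ * s b ≤ _
  change ∑ b, s b ≤ _ at this
  linarith

/-- The affine points of `y² = x³ + b`. -/
def affPts (b : F) : Finset (F × F) := univ.filter fun P => P.2 ^ 2 = P.1 ^ 3 + b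

lemma card_affPts (hF : ringChar F ≠ 2) (b : F) :
    ((affPts b).card : ℤ) = Fintype.card F + ∑ x : F, quadraticChar F (x ^ 3 + b) := by
  have : (affPts b).card = ∑ x : F, (univ.filter fun y : F => y ^ 2 = x ^ 3 + b).card := by
    rw [affPts, ← Finset.univ_product_univ, Finset.card_filter, Finset.sum_product]
    simp_rw [Finset.card_filter]
  rw [this, Nat.cast_sum]
  have e : ∀ x : F, ((univ.filter fun y : F => y ^ 2 = x ^ 3 + b).card : ℤ)
      = quadraticChar F (x ^ 3 + b) + 1 := by
    intro x
    rw [← quadraticChar_card_sqrts hF]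
    congr 2
    ext y; simp
  simp_rw [e]
  rw [Finset.sum_add_distrib]
  simp [add_comm]

lemma card_affPts_ge (hF : ringChar F ≠ 2) (hq : 9887 < Fintype.card F) {b : F} (hb : b ≠ 0) :
    3 * Fintype.card F + 400 ≤ 4 * (affPts b).card := by
  have h1 := card_affPts hF b
  have h2 := charSum_sq_le hF hb
  set a := ∑ x : F, quadraticChar F (x ^ 3 + b)
  have hq' : (9887 : ℤ) < Fintype.card F := by exact_mod_cast hq
  zify
  rw [h1]
  generalize (Fintype.card F : ℤ) = q at *
  by_contra! h
  have h3 : q - 400 < -(4 * a) := by linarith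
  have h4 : (q - 400) ^ 2 ≤ 16 * a ^ 2 := by nlinarith
  have h5 : (q - 1) * (q - 400) ^ 2 ≤ (q - 1) * (16 * a ^ 2) :=
    mul_le_mul_of_nonneg_left h4 (by linarith)
  have h6 : (9000 * q) * (q - 400) ≤ (q - 1) * (q - 400) ^ 2 := by
    have : 9000 * q ≤ (q - 1) * (q - 400) := by nlinarith
    nlinarith
  nlinarith

/-- The discriminant of the cubic `x³ + b - (m x + c)²`. -/
def lineDisc (b m c : F) : F :=
  4 * b * m ^ 6 - 4 * m ^ 3 * c ^ 3 + 36 * b * m ^ 3 * c - 27 * (c ^ 2 - b) ^ 2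

/-- Abscissae of the points of `y² = x³ + b` on the line `y = m x + c`. -/
def lineRoots (b m c : F) : Finset F := univ.filter fun x => (m * x + c) ^ 2 = x ^ 3 + b

lemma mem_lineRoots {b m c x : F} : x ∈ lineRoots b m c ↔ (m * x + c) ^ 2 = x ^ 3 + b := by
  simp [lineRoots]

lemma card_filter_eval_eq_zero_le (p : F[X]) (hp : p ≠ 0) {d : ℕ} (hd : p.natDegree ≤ d) :
    (univ.filter fun x => p.eval x = 0).card ≤ d := by
  have : (univ.filter fun x => p.eval x = 0) ⊆ p.roots.toFinset := by
    intro x hx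
    simpa [hp] using hx
  exact (card_le_card this).trans ((Multiset.toFinset_card_le _).trans ((card_roots' p).trans hd))

lemma card_lineRoots_le (b m c : F) : (lineRoots b m c).card ≤ 3 := by
  have hd : (X ^ 3 + C b - (C m * X + C c) ^ 2 : F[X]).natDegree = 3 := by
    have : (X ^ 3 + C b - (C m * X + C c) ^ 2 : F[X])
      = X ^ 3 - C (m ^ 2) * X ^ 2 - C (2 * m * c) * X + C (b - c ^ 2) := by
      simp only [C_mul, C_pow, C_sub, map_ofNat]; ring
    rw [this]; compute_degree!
  have h := card_filter_eval_eq_zero_le _ (ne_zero_of_natDegree_gt (n := 0) (by omega)) hd.le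
  refine (card_le_card fun x hx => ?_).trans h
  rw [mem_lineRoots] at hx
  simp [hx]

lemma lineDisc_eq {b m c x : F} (hx : x ∈ lineRoots b m c) :
    lineDisc b m c = ((x - m ^ 2) ^ 2 - 4 * (x ^ 2 - m ^ 2 * x - 2 * m * c))
      * (x ^ 2 + (x - m ^ 2) * x + (x ^ 2 - m ^ 2 * x - 2 * m * c)) ^ 2 := by
  rw [mem_lineRoots] at hx
  obtain rfl : b = (m * x + c) ^ 2 - x ^ 3 := by rw [hx]; ring
  unfold lineDisc; ring

lemma three_le_card_lineRoots (h2 : (2 : F) ≠ 0) {b m c x : F} (hx : x ∈ lineRoots b m c)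
    (h0 : lineDisc b m c ≠ 0) (hsq : IsSquare (lineDisc b m c)) :
    3 ≤ (lineRoots b m c).card := by
  have he := lineDisc_eq hx
  set u := x - m ^ 2 with hu
  set v := x ^ 2 - m ^ 2 * x - 2 * m * c with hv
  set k := x ^ 2 + u * x + v with hk
  have hk0 : k ≠ 0 := by rintro h; simp [he, h] at h0
  obtain ⟨s, hs⟩ : IsSquare (u ^ 2 - 4 * v) := by
    obtain ⟨r, hr⟩ := hsq
    refine ⟨r / k, ?_⟩
    field_simp
    rw [← he, hr]; ring
  have hs0 : s ≠ 0 := by rintro rfl; simp [he, hs] at h0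
  have hroot : ∀ z, z ^ 2 + u * z + v = 0 → z ∈ lineRoots b m c ∧ z ≠ x := by
    intro z hz
    constructor
    · rw [mem_lineRoots] at hx ⊢
      linear_combination hx - (z - x) * hz
    · rintro rfl; exact hk0 hz
  have hz1 := hroot ((-u + s) / 2) (by field_simp; linear_combination -hs)
  have hz2 := hroot ((-u - s) / 2) (by field_simp; linear_combination -hs)
  have hne : (-u + s) / 2 ≠ (-u - s) / 2 := by
    intro h
    field_simp at h
    have : 2 * s = 0 := by linear_combination h
    exact (mul_ne_zero h2 hs0) this
  have : ({x, (-u + s) / 2, (-u - s) / 2} : Finset F) ⊆ lineRoots b m c := by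
    intro z hz
    simp only [mem_insert, mem_singleton] at hz
    rcases hz with rfl | rfl | rfl
    exacts [hx, hz1.1, hz2.1]
  refine le_trans (le_of_eq ?_) (card_le_card this)
  rw [card_eq_three.2 ⟨_, _, _, hz1.2.symm, hz2.2.symm, hne, rfl⟩]

lemma card_lineRoots_le_one {b m c : F} (hsq : ¬ IsSquare (lineDisc b m c)) :
    (lineRoots b m c).card ≤ 1 := by
  rw [card_le_one]
  intro x hx z hz
  by_contra hne
  apply hsq
  rw [lineDisc_eq hx]
  rw [mem_lineRoots] at hx hz
  have hq : z ^ 2 + (x - m ^ 2) * z + (x ^ 2 - m ^ 2 * x - 2 * m * c) = 0 := by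
    refine mul_left_cancel₀ (sub_ne_zero.2 (Ne.symm hne)) ?_
    linear_combination hx - hz
  have : (x - m ^ 2) ^ 2 - 4 * (x ^ 2 - m ^ 2 * x - 2 * m * c) = (2 * z + (x - m ^ 2)) ^ 2 := by
    linear_combination -4 * hq
  rw [this, ← mul_pow]
  exact IsSquare.sq _

/-- In a one-parameter family of lines whose discriminant is, up to squares, a polynomial of degree
at most six with a nonzero square value, many members meet the curve in three points. -/
lemma seven_le_card_threeSecants (h2 : (2 : F) ≠ 0) {b : F} (m c s σ : F → F) (Q : F[X])
    (hQ : Q.natDegree ≤ 6) (hσ : Function.Injective σ) (hs : ∀ t, t ≠ 0 → s t ≠ 0)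
    (hD : ∀ t, t ≠ 0 → lineDisc b (m t) (c t) = s t ^ 2 * Q.eval (σ t))
    {a : F} (ha : Q.eval a ≠ 0) (hasq : IsSquare (Q.eval a)) (E : Finset (F × F)) (hE : E.card ≤ 2)
    (hcov : ∀ P ∈ affPts b, P ∉ E → ∃ t, P.2 = m t * P.1 + c t)
    (hA : 3 * Fintype.card F + 400 ≤ 4 * (affPts b).card) :
    7 ≤ (univ.filter fun t => 3 ≤ (lineRoots b (m t) (c t)).card).card := by
  set G := univ.filter fun t => 3 ≤ (lineRoots b (m t) (c t)).card with hG
  set Z := univ.filter fun t => lineDisc b (m t) (c t) = 0 with hZ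
  set N := univ.filter fun t => ¬ IsSquare (lineDisc b (m t) (c t)) with hN
  have hZc : Z.card ≤ 7 := by
    have h1 : (Z.erase 0).card ≤ 6 := by
      refine le_trans ?_ (card_filter_eval_eq_zero_le Q (by rintro rfl; simp at ha) hQ)
      refine card_le_card_of_injOn σ (fun t ht => ?_) hσ.injOn
      simp only [hZ, coe_erase, coe_filter, mem_univ, true_and, Set.mem_sdiff, Set.mem_ofPred_eq,
        Set.mem_singleton_iff] at ht
      have := hD t ht.2
      rw [ht.1] at this
      simpa using (mul_eq_zero.1 this.symm).resolve_left (pow_ne_zero _ (hs t ht.2))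
    have := Finset.pred_card_le_card_erase (s := Z) (a := 0)
    omega
  have hNc : 4 * N.card ≤ 3 * Fintype.card F + 19 := by
    have h1 := four_mul_card_nonsquare_le h2 Q hQ a ha hasq
    have h3 : (N.erase 0).card ≤ (univ.filter fun a => ¬ IsSquare (Q.eval a)).card := by
      refine card_le_card_of_injOn σ (fun t ht => ?_) hσ.injOn
      simp only [hN, coe_erase, coe_filter, mem_univ, true_and, Set.mem_sdiff, Set.mem_ofPred_eq,
        Set.mem_singleton_iff] at ht
      simp only [coe_filter, mem_univ, true_and, Set.mem_ofPred_eq]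
      intro hsq
      apply ht.1
      rw [hD t ht.2]
      exact (IsSquare.sq _).mul hsq
    have := Finset.pred_card_le_card_erase (s := N) (a := 0)
    omega
  have hcover : affPts b \ E ⊆
      univ.biUnion fun t => (lineRoots b (m t) (c t)).image fun x => (x, m t * x + c t) := by
    intro P hP
    rw [mem_sdiff] at hP
    obtain ⟨t, ht⟩ := hcov P hP.1 hP.2
    simp only [mem_biUnion, mem_univ, true_and, mem_image, mem_lineRoots]
    refine ⟨t, P.1, ?_, by rw [← ht]⟩
    rw [← ht]
    simpa [affPts] using hP.1
  have hle : (affPts b).card ≤ ∑ t, (lineRoots b (m t) (c t)).card + 2 := by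
    have h1 := (card_le_card hcover).trans card_biUnion_le
    have h3 := h1.trans (sum_le_sum fun t _ => card_image_le)
    have h4 := le_card_sdiff E (affPts b)
    omega
  have hsum : ∑ t, (lineRoots b (m t) (c t)).card ≤ ∑ t,
      (3 * (if t ∈ G then 1 else 0) + 3 * (if t ∈ Z then 1 else 0) + if t ∈ N then 1 else 0) := by
    refine sum_le_sum fun t _ => ?_
    have h3 := card_lineRoots_le b (m t) (c t)
    by_cases hz : t ∈ Z
    · simp only [hz, if_true]; omega
    by_cases hg : t ∈ G
    · simp only [hg, if_true]; omega
    by_cases hn : t ∈ N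
    · have := card_lineRoots_le_one (mem_filter.1 hn).2
      simp only [hn, if_true]; omega
    · have hz' : lineDisc b (m t) (c t) ≠ 0 := by simpa [hZ] using hz
      have hn' : IsSquare (lineDisc b (m t) (c t)) := by simpa [hN] using hn
      have : (lineRoots b (m t) (c t)).card = 0 := by
        rw [card_eq_zero, eq_empty_iff_forall_notMem]
        intro x hx
        exact hg (by simpa [hG] using three_le_card_lineRoots h2 hx hz' hn')
      omega
  simp only [sum_add_distrib, ← mul_sum, sum_boole, Nat.cast_id] at hsum
  have e : ∀ S : Finset F, (univ.filter fun t => t ∈ S) = S := fun S => by ext; simp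
  simp only [e] at hsum
  omega

/-- The rational points of `y² = x³ + b`, with `none` as the point at infinity. -/
def curvePts (b : F) : Finset (Option (F × F)) := (affPts b).insertNone

lemma card_affPts_fiber_le (b t : F) : ((affPts b).filter fun P => P.1 = t).card ≤ 2 := by
  have hd : (X ^ 2 - C (t ^ 3 + b) : F[X]).natDegree = 2 := natDegree_X_pow_sub_C
  have := card_filter_eval_eq_zero_le _ (ne_zero_of_natDegree_gt (n := 0) (by omega)) hd.le
  refine le_trans (card_le_card_of_injOn Prod.snd (fun P hP => ?_) ?_) this
  · simp only [coe_filter, affPts, mem_filter, mem_univ, true_and, Set.mem_ofPred_eq] at hP ⊢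
    simp [hP.1, ← hP.2]
  · intro P hP R hR h
    simp only [coe_filter, Set.mem_ofPred_eq] at hP hR
    exact Prod.ext (hP.2.trans hR.2.symm) h

/-- Homogeneous coordinates in the plane. -/
def planeVec : Option (F × F) → Fin 3 → F
  | none => ![0, 0, 1]
  | some P => ![1, P.1, P.2]

/-- The points of the curve on the line with coefficient vector `l`. -/
def lineZeros (b : F) (l : Fin 3 → F) : Finset (Option (F × F)) :=
  (curvePts b).filter fun P => l ⬝ᵥ planeVec P = 0

lemma dotProduct_planeVec_some (l : Fin 3 → F) (P : F × F) :
    l ⬝ᵥ planeVec (some P) = l 0 + l 1 * P.1 + l 2 * P.2 := by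
  simp [planeVec, dotProduct, Fin.sum_univ_three]

lemma dotProduct_planeVec_none (l : Fin 3 → F) : l ⬝ᵥ planeVec none = l 2 := by
  simp [planeVec, dotProduct, Fin.sum_univ_three]

lemma some_mem_lineZeros {b : F} {l : Fin 3 → F} {P : F × F} :
    some P ∈ lineZeros b l ↔ P.2 ^ 2 = P.1 ^ 3 + b ∧ l 0 + l 1 * P.1 + l 2 * P.2 = 0 := by
  simp [lineZeros, curvePts, dotProduct_planeVec_some, affPts]

lemma none_mem_lineZeros {b : F} {l : Fin 3 → F} : none ∈ lineZeros b l ↔ l 2 = 0 := by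
  simp [lineZeros, curvePts, dotProduct_planeVec_none]

lemma three_le_card_lineZeros {b m c : F} (h : 3 ≤ (lineRoots b m c).card) :
    3 ≤ (lineZeros b ![c, m, -1]).card := by
  refine h.trans (card_le_card_of_injOn (fun x => some (x, m * x + c)) (fun x hx => ?_) ?_)
  · rw [mem_coe, mem_lineRoots] at hx
    rw [mem_coe, some_mem_lineZeros]
    refine ⟨hx, ?_⟩
    simp; ring
  · intro x _ y _ hxy
    simp only [Option.some.injEq, Prod.mk.injEq] at hxy
    exact hxy.1

/-- The lines through the point `w`, parametrized as `v₀ + t v₁`, have many members meeting the curve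
in three rational points. -/
structure IsRichPencil (b : F) (w v₀ v₁ : Fin 3 → F) : Prop where
  left : v₀ ⬝ᵥ w = 0
  right : v₁ ⬝ᵥ w = 0
  span : ∀ l : Fin 3 → F, l ⬝ᵥ w = 0 → ∃ x y : F, l = x • v₀ + y • v₁
  ne_zero : ∀ t : F, v₀ + t • v₁ ≠ 0
  many : 7 ≤ (univ.filter fun t : F => 3 ≤ (lineZeros b (v₀ + t • v₁)).card).card

lemma exists_isRichPencil_affine (h2 : (2 : F) ≠ 0) (h3 : (3 : F) ≠ 0) (hm3 : IsSquare (-3 : F))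
    {b : F} (hb : b ≠ 0) (hA : 3 * Fintype.card F + 400 ≤ 4 * (affPts b).card)
    {w : Fin 3 → F} (hw : w 0 ≠ 0) : ∃ v₀ v₁, IsRichPencil b w v₀ v₁ := by
  set x₀ := w 1 / w 0 with hx
  set y₀ := w 2 / w 0 with hy
  have hw1 : w 1 = x₀ * w 0 := by rw [hx]; field_simp
  have hw2 : w 2 = y₀ * w 0 := by rw [hy]; field_simp
  have hl : ∀ t : F, (![y₀, 0, -1] + t • ![-x₀, 1, 0] : Fin 3 → F) = ![y₀ - t * x₀, t, -1] := by
    intro t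
    ext i; fin_cases i <;> simp [sub_eq_add_neg]
  refine ⟨![y₀, 0, -1], ![-x₀, 1, 0], ?_, ?_, fun l h => ⟨-l 2, l 1, ?_⟩, fun t h => ?_, ?_⟩
  · simp [dotProduct, Fin.sum_univ_three, hw2]
  · simp [dotProduct, Fin.sum_univ_three, hw1]
  · simp only [dotProduct, Fin.sum_univ_three, hw1, hw2] at h
    ext i; fin_cases i
    · simp
      refine mul_right_cancel₀ hw ?_
      linear_combination h
    · simp
    · simp
  · rw [hl] at h
    simpa using congrFun h 2
  · have key : 7 ≤ (univ.filter fun t => 3 ≤ (lineRoots b t (y₀ - t * x₀)).card).card := by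
      have hcov : ∀ P ∈ affPts b, P ∉ ((affPts b).filter fun P => P.1 = x₀) →
          ∃ t, P.2 = t * P.1 + (y₀ - t * x₀) := by
        intro P hP hPE
        have hne : P.1 - x₀ ≠ 0 := by
          intro h
          have h' := sub_eq_zero.1 h
          exact hPE (by simp [h', hP])
        refine ⟨(P.2 - y₀) / (P.1 - x₀), ?_⟩
        field_simp
        ring
      have h27 : ∀ z : F, IsSquare (-27 * z ^ 2) := by
        intro z
        have : (-27 * z ^ 2 : F) = -3 * (3 * z) ^ 2 := by ring
        rw [this]; exact hm3.mul (IsSquare.sq _)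
      have h270 : (-27 : F) ≠ 0 := by
        have : (-27 : F) = -3 ^ 3 := by norm_num
        rw [this]; exact neg_ne_zero.2 (pow_ne_zero _ h3)
      by_cases hyb : y₀ ^ 2 = b
      · have hy0 : y₀ ≠ 0 := by
          rintro h; rw [h] at hyb; exact hb (by rw [← hyb]; simp)
        by_cases hx0 : x₀ = 0
        · refine seven_le_card_threeSecants h2 (fun t => t) (fun t => y₀ - t * x₀) (fun t => t ^ 3)
            (fun t => t⁻¹) (C (4 * b) * (1 + C (8 * y₀) * X ^ 3)) ?_ inv_injective
            (fun t ht => pow_ne_zero _ ht) (fun t ht => ?_) (a := 0) ?_ ?_ _ (card_affPts_fiber_le b x₀) hcov hA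
          · compute_degree; norm_num
          · simp only [lineDisc, hx0, ← hyb, eval_mul, eval_C, eval_add, eval_one, eval_pow, eval_X]
            field_simp
            ring
          · simpa [hb] using (by
              have : (4 : F) = 2 ^ 2 := by norm_num
              rw [this]; exact pow_ne_zero _ h2 : (4 : F) ≠ 0)
          · have : eval 0 (C (4 * b) * (1 + C (8 * y₀) * X ^ 3)) = (2 * y₀) ^ 2 := by
              simp [← hyb]; ring
            rw [this]; exact IsSquare.sq _
        · have he : eval 0 (C (4 * b) * X ^ 4 - C 4 * X * (C y₀ - C x₀ * X) ^ 3
              + C (36 * b) * X * (C y₀ - C x₀ * X) - C (27 * x₀ ^ 2) * (C x₀ * X - C (2 * y₀)) ^ 2)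
              = -27 * (2 * x₀ * y₀) ^ 2 := by
            simp; ring
          refine seven_le_card_threeSecants h2 (fun t => t) (fun t => y₀ - t * x₀) (fun t => t)
            (fun t => t) (C (4 * b) * X ^ 4 - C 4 * X * (C y₀ - C x₀ * X) ^ 3
              + C (36 * b) * X * (C y₀ - C x₀ * X) - C (27 * x₀ ^ 2) * (C x₀ * X - C (2 * y₀)) ^ 2)
            ?_ (fun _ _ h => h) (fun t ht => ht) (fun t ht => ?_) (a := 0) ?_ ?_ _ (card_affPts_fiber_le b x₀) hcov hA
          · compute_degree; norm_num
          · simp only [lineDisc, ← hyb, eval_mul, eval_C, eval_add, eval_sub, eval_pow, eval_X]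
            ring
          · rw [he]
            exact mul_ne_zero h270 (pow_ne_zero _ (mul_ne_zero (mul_ne_zero h2 hx0) hy0))
          · rw [he]; exact h27 _
      · have he : eval 0 (C (4 * b) * X ^ 6 - C 4 * X ^ 3 * (C y₀ - C x₀ * X) ^ 3
              + C (36 * b) * X ^ 3 * (C y₀ - C x₀ * X) - C 27 * ((C y₀ - C x₀ * X) ^ 2 - C b) ^ 2)
              = -27 * (y₀ ^ 2 - b) ^ 2 := by
          simp
        refine seven_le_card_threeSecants h2 (fun t => t) (fun t => y₀ - t * x₀) (fun t => 1)
          (fun t => t) (C (4 * b) * X ^ 6 - C 4 * X ^ 3 * (C y₀ - C x₀ * X) ^ 3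
              + C (36 * b) * X ^ 3 * (C y₀ - C x₀ * X) - C 27 * ((C y₀ - C x₀ * X) ^ 2 - C b) ^ 2)
          ?_ (fun _ _ h => h) (fun t ht => one_ne_zero) (fun t ht => ?_) (a := 0) ?_ ?_ _ (card_affPts_fiber_le b x₀) hcov hA
        · compute_degree
        · simp only [lineDisc, eval_mul, eval_C, eval_add, eval_sub, eval_pow, eval_X]
          ring
        · rw [he]
          exact mul_ne_zero h270 (pow_ne_zero _ (sub_ne_zero.2 hyb))
        · rw [he]; exact h27 _
    refine key.trans (card_le_card fun t ht => ?_)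
    simp only [mem_filter, mem_univ, true_and] at ht ⊢
    rw [hl]
    exact three_le_card_lineZeros ht

lemma exists_isRichPencil_direction (h2 : (2 : F) ≠ 0) (h3 : (3 : F) ≠ 0) (hm3 : IsSquare (-3 : F))
    {b : F} (hA : 3 * Fintype.card F + 400 ≤ 4 * (affPts b).card)
    {w : Fin 3 → F} (hw : w 0 = 0) (hw1 : w 1 ≠ 0) : ∃ v₀ v₁, IsRichPencil b w v₀ v₁ := by
  set m := w 2 / w 1 with hm
  have hw2 : w 2 = m * w 1 := by rw [hm]; field_simp
  have hl : ∀ t : F, (![0, m, -1] + t • ![1, 0, 0] : Fin 3 → F) = ![t, m, -1] := by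
    intro t
    ext i; fin_cases i <;> simp
  refine ⟨![0, m, -1], ![1, 0, 0], ?_, ?_, fun l h => ⟨-l 2, l 0, ?_⟩, fun t h => ?_, ?_⟩
  · simp [dotProduct, Fin.sum_univ_three, hw2]
  · simp [dotProduct, Fin.sum_univ_three, hw]
  · simp only [dotProduct, Fin.sum_univ_three, hw, hw2] at h
    ext i; fin_cases i
    · simp
    · simp
      refine mul_right_cancel₀ hw1 ?_
      linear_combination h
    · simp
  · rw [hl] at h
    simpa using congrFun h 2
  · have key : 7 ≤ (univ.filter fun t => 3 ≤ (lineRoots b m t).card).card := by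
      have he : eval 0 (C (-27) - C (4 * m ^ 3) * X + C (54 * b) * X ^ 2 + C (36 * b * m ^ 3) * X ^ 3
          + C (4 * b * m ^ 6 - 27 * b ^ 2) * X ^ 4) = -27 := by
        simp
      refine seven_le_card_threeSecants h2 (fun _ => m) (fun t => t) (fun t => t ^ 2)
        (fun t => t⁻¹) (C (-27) - C (4 * m ^ 3) * X + C (54 * b) * X ^ 2 + C (36 * b * m ^ 3) * X ^ 3
          + C (4 * b * m ^ 6 - 27 * b ^ 2) * X ^ 4) ?_ inv_injective
        (fun t ht => pow_ne_zero _ ht) (fun t ht => ?_) (a := 0) ?_ ?_ ∅ (by simp)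
        (fun P _ _ => ⟨P.2 - m * P.1, by ring⟩) hA
      · compute_degree; norm_num
      · simp only [lineDisc, eval_mul, eval_C, eval_add, eval_sub, eval_pow, eval_X]
        field_simp
        ring
      · rw [he]
        have : (-27 : F) = -3 ^ 3 := by norm_num
        rw [this]; exact neg_ne_zero.2 (pow_ne_zero _ h3)
      · rw [he]
        have : (-27 : F) = -3 * 3 ^ 2 := by norm_num
        rw [this]; exact hm3.mul (IsSquare.sq _)
    refine key.trans (card_le_card fun t ht => ?_)
    simp only [mem_filter, mem_univ, true_and] at ht ⊢
    rw [hl]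
    exact three_le_card_lineZeros ht

lemma exists_isRichPencil_infinity (h2 : (2 : F) ≠ 0)
    {b : F} (hA : 3 * Fintype.card F + 400 ≤ 4 * (affPts b).card)
    {w : Fin 3 → F} (hw : w 0 = 0) (hw1 : w 1 = 0) (hw2 : w 2 ≠ 0) :
    ∃ v₀ v₁, IsRichPencil b w v₀ v₁ := by
  have hl : ∀ t : F, (![0, 1, 0] + t • ![-1, 0, 0] : Fin 3 → F) = ![-t, 1, 0] := by
    intro t
    ext i; fin_cases i <;> simp
  refine ⟨![0, 1, 0], ![-1, 0, 0], ?_, ?_, fun l h => ⟨l 1, -l 0, ?_⟩, fun t h => ?_, ?_⟩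
  · simp [dotProduct, Fin.sum_univ_three, hw1]
  · simp [dotProduct, Fin.sum_univ_three, hw]
  · simp only [dotProduct, Fin.sum_univ_three, hw, hw1] at h
    ext i; fin_cases i
    · simp
    · simp
    · simpa [hw2] using h
  · rw [hl] at h
    simpa using congrFun h 1
  · set G := univ.filter fun t : F => 3 ≤ (lineZeros b (![0, 1, 0] + t • ![-1, 0, 0])).card with hG
    have hzero : ((affPts b).filter fun P => P.2 = 0).card ≤ 3 := by
      refine le_trans (card_le_card_of_injOn Prod.fst (fun P hP => ?_) ?_) (card_cube_eq_le (-b))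
      · simp only [coe_filter, affPts, mem_filter, mem_univ, true_and, Set.mem_ofPred_eq] at hP ⊢
        have := hP.1
        rw [hP.2] at this
        linear_combination -this
      · intro P hP R hR h
        simp only [coe_filter, Set.mem_ofPred_eq] at hP hR
        exact Prod.ext h (hP.2.trans hR.2.symm)
    have hnz : ((affPts b).filter fun P => ¬ P.2 = 0).card ≤ 2 * G.card := by
      refine card_le_mul_card_image_of_maps_to (f := Prod.fst) (fun P hP => ?_) 2 fun t _ => ?_
      · simp only [affPts, mem_filter, mem_univ, true_and] at hP
        simp only [hG, mem_filter, mem_univ, true_and, hl]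
        have hne : P.2 ≠ -P.2 := by
          intro h
          have : 2 * P.2 = 0 := by linear_combination h
          exact mul_ne_zero h2 hP.2 this
        have hsub : ({none, some (P.1, P.2), some (P.1, -P.2)} : Finset (Option (F × F)))
            ⊆ lineZeros b ![-P.1, 1, 0] := by
          intro R hR
          simp only [mem_insert, mem_singleton] at hR
          rcases hR with rfl | rfl | rfl
          · simp [none_mem_lineZeros]
          · rw [some_mem_lineZeros]; simp [hP.1]
          · rw [some_mem_lineZeros]; simp [hP.1]
        refine le_trans (le_of_eq ?_) (card_le_card hsub)
        exact (card_eq_three.2 ⟨_, _, _, by simp, by simp,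
          fun h => hne (congrArg Prod.snd (Option.some.inj h)), rfl⟩).symm
      · refine le_trans (card_le_card ?_) (card_affPts_fiber_le b t)
        intro P hP
        simp only [mem_filter] at hP ⊢
        exact ⟨hP.1.1, hP.2⟩
    have := card_filter_add_card_filter_not (s := affPts b) (fun P => P.2 = 0)
    omega

lemma exists_isRichPencil (h2 : (2 : F) ≠ 0) (h3 : (3 : F) ≠ 0) (hm3 : IsSquare (-3 : F))
    {b : F} (hb : b ≠ 0) (hA : 3 * Fintype.card F + 400 ≤ 4 * (affPts b).card)
    {w : Fin 3 → F} (hw : w ≠ 0) : ∃ v₀ v₁, IsRichPencil b w v₀ v₁ := by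
  by_cases h0 : w 0 = 0
  · by_cases h1 : w 1 = 0
    · refine exists_isRichPencil_infinity h2 hA h0 h1 fun h => hw ?_
      ext i; fin_cases i <;> assumption
    · exact exists_isRichPencil_direction h2 h3 hm3 hA h0 h1
  · exact exists_isRichPencil_affine h2 h3 hm3 hb hA h0

lemma card_filter_sum_mul_pow_eq_zero_le {d : ℕ} {c : Fin (d + 1) → F} (hc : c ≠ 0) :
    (univ.filter fun x : F => ∑ i, c i * x ^ (i : ℕ) = 0).card ≤ d := by
  set p : F[X] := ∑ i : Fin (d + 1), C (c i) * X ^ (i : ℕ) with hp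
  have hcoeff (i : Fin (d + 1)) : p.coeff i = c i := by
    simp [hp, coeff_C_mul, coeff_X_pow, Fin.val_inj]
  have hp0 : p ≠ 0 := by
    rintro h
    exact hc (funext fun i => by simp [← hcoeff, h])
  have hd : p.natDegree ≤ d :=
    natDegree_sum_le_of_forall_le _ _ fun i _ =>
      (natDegree_C_mul_X_pow_le _ _).trans (Nat.lt_succ_iff.mp i.2)
  simpa [hp, eval_finsetSum] using card_filter_eval_eq_zero_le p hp0 hd

/-- A set of points whose ordinate is a function of the abscissa is no larger than the number
of roots of a polynomial satisfied by the abscissae. -/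
lemma card_le_of_graph {d : ℕ} {c : Fin (d + 1) → F} (hc : c ≠ 0) {S : Finset (F × F)}
    (f g : F → F) (hg : ∀ P ∈ S, g P.1 ≠ 0) (hfg : ∀ P ∈ S, f P.1 + g P.1 * P.2 = 0)
    (hS : ∀ P ∈ S, ∑ i, c i * P.1 ^ (i : ℕ) = 0) : S.card ≤ d := by
  refine (card_le_card_of_injOn Prod.fst (fun P hP => ?_) ?_).trans
    (card_filter_sum_mul_pow_eq_zero_le hc)
  · simpa using hS P hP
  · intro P hP R hR h
    refine Prod.ext h (mul_left_cancel₀ (hg P hP) ?_)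
    have h1 := hfg P hP
    have h2 := hfg R hR
    rw [h] at h1 ⊢
    linear_combination h1 - h2

/-- A set of points of the curve whose abscissae are roots of a polynomial of degree at most `d`
has at most `2 * d` elements. -/
lemma card_le_of_fst {d : ℕ} {c : Fin (d + 1) → F} (hc : c ≠ 0) {b : F} {S : Finset (F × F)}
    (hb : S ⊆ affPts b) (hS : ∀ P ∈ S, ∑ i, c i * P.1 ^ (i : ℕ) = 0) : S.card ≤ 2 * d := by
  refine (card_le_mul_card_image_of_maps_to (f := Prod.fst)
    (t := univ.filter fun x : F => ∑ i, c i * x ^ (i : ℕ) = 0) (fun P hP => ?_) 2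
    fun x _ => ?_).trans (Nat.mul_le_mul_left 2 (card_filter_sum_mul_pow_eq_zero_le hc))
  · simpa using hS P hP
  · exact (card_le_card (filter_subset_filter _ hb)).trans (card_affPts_fiber_le b x)

lemma card_le_card_eraseNone_add_one {α : Type*} [DecidableEq α] (s : Finset (Option α)) :
    s.card ≤ s.eraseNone.card + if none ∈ s then 1 else 0 := by
  split_ifs with h
  · have := card_eraseNone_of_mem h; omega
  · rw [card_eraseNone_of_not_mem h]; omega

/-- A line meets the curve in at most three points. -/
lemma card_lineZeros_le {b : F} {l : Fin 3 → F} (hl : l ≠ 0) : (lineZeros b l).card ≤ 3 := by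
  set S := (lineZeros b l).eraseNone with hSdef
  have hmem {P : F × F} (hP : P ∈ S) :
      P.2 ^ 2 = P.1 ^ 3 + b ∧ l 0 + l 1 * P.1 + l 2 * P.2 = 0 := by
    rwa [hSdef, mem_eraseNone, some_mem_lineZeros] at hP
  have hle := card_le_card_eraseNone_add_one (lineZeros b l)
  rw [← hSdef] at hle
  by_cases h2 : l 2 = 0
  · have hS : S.card ≤ 2 * 1 := by
      refine card_le_of_fst (b := b) (c := ![l 0, l 1]) ?_ (fun P hP => ?_) fun P hP => ?_
      · intro h
        refine hl (funext fun i => ?_)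
        have h0 := congrFun h 0
        have h1 := congrFun h 1
        fin_cases i
        exacts [h0, h1, h2]
      · simpa [affPts] using (hmem hP).1
      · simpa [Fin.sum_univ_two, h2] using (hmem hP).2
    split_ifs at hle <;> omega
  · have hn : none ∉ lineZeros b l := by rw [none_mem_lineZeros]; exact h2
    rw [if_neg hn] at hle
    refine hle.trans ?_
    refine card_le_of_graph (d := 3)
      (c := ![l 0 ^ 2 - l 2 ^ 2 * b, 2 * l 0 * l 1, l 1 ^ 2, - l 2 ^ 2]) ?_
      (fun x => l 0 + l 1 * x) (fun _ => l 2) (fun _ _ => h2) (fun P hP => (hmem hP).2) ?_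
    · intro h
      have := congrFun h 3
      simp at this
      exact h2 this
    · intro P hP
      obtain ⟨h, h'⟩ := hmem hP
      simp [Fin.sum_univ_succ]
      linear_combination (l 0 + l 1 * P.1 - l 2 * P.2) * h' + l 2 ^ 2 * h

/-- The values at a point of the curve of the monomials of degree two. -/
def conicVec : Option (F × F) → Fin 6 → F
  | none => ![0, 0, 0, 0, 0, 1]
  | some P => ![1, P.1, P.2, P.1 ^ 2, P.1 * P.2, P.2 ^ 2]

/-- The points of the curve on the conic with coefficient vector `a`. -/
def conicZeros (b : F) (a : Fin 6 → F) : Finset (Option (F × F)) :=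
  (curvePts b).filter fun P => a ⬝ᵥ conicVec P = 0

lemma some_mem_conicZeros {b : F} {a : Fin 6 → F} {P : F × F} :
    some P ∈ conicZeros b a ↔ P.2 ^ 2 = P.1 ^ 3 + b ∧
      a 0 + a 1 * P.1 + a 2 * P.2 + a 3 * P.1 ^ 2 + a 4 * (P.1 * P.2) + a 5 * P.2 ^ 2 = 0 := by
  simp [conicZeros, curvePts, affPts, conicVec, dotProduct, Fin.sum_univ_six]

lemma none_mem_conicZeros {b : F} {a : Fin 6 → F} : none ∈ conicZeros b a ↔ a 5 = 0 := by
  simp [conicZeros, curvePts, conicVec, dotProduct, Fin.sum_univ_six]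

lemma card_affine_conicZeros_le {b a₀ a₁ a₂ a₃ a₄ a₅ : F} {S : Finset (F × F)}
    (ha : ¬ (a₀ = 0 ∧ a₁ = 0 ∧ a₂ = 0 ∧ a₃ = 0 ∧ a₄ = 0 ∧ a₅ = 0)) (hSb : S ⊆ affPts b)
    (hS : ∀ P ∈ S, a₀ + a₁ * P.1 + a₂ * P.2 + a₃ * P.1 ^ 2 + a₄ * (P.1 * P.2)
      + a₅ * P.2 ^ 2 = 0) : S.card ≤ 6 ∧ (a₅ = 0 → S.card ≤ 5) := by
  have hcurve {P : F × F} (hP : P ∈ S) : P.2 ^ 2 = P.1 ^ 3 + b := by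
    simpa [affPts] using hSb hP
  have hlin {P : F × F} (hP : P ∈ S) :
      (a₀ + a₅ * b + a₁ * P.1 + a₃ * P.1 ^ 2 + a₅ * P.1 ^ 3) + (a₂ + a₄ * P.1) * P.2 = 0 := by
    linear_combination hS P hP - a₅ * hcurve hP
  by_cases h4 : a₄ = 0
  · subst h4
    by_cases h2 : a₂ = 0
    · subst h2
      constructor
      · refine card_le_of_fst (d := 3) (c := ![a₀ + a₅ * b, a₁, a₃, a₅]) ?_ hSb fun P hP => ?_
        · intro h
          have h0 := congrFun h 0
          have h1 := congrFun h 1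
          have h2 := congrFun h 2
          have h3 := congrFun h 3
          simp at h0 h1 h2 h3
          refine ha ⟨?_, h1, rfl, h2, rfl, h3⟩
          simpa [h3] using h0
        · have := hlin hP
          simp [Fin.sum_univ_succ]
          linear_combination this
      · rintro rfl
        refine (card_le_of_fst (d := 2) (c := ![a₀, a₁, a₃]) ?_ hSb fun P hP => ?_).trans
          (by norm_num)
        · intro h
          have h0 := congrFun h 0
          have h1 := congrFun h 1
          have h2 := congrFun h 2
          simp at h0 h1 h2
          exact ha ⟨h0, h1, rfl, h2, rfl, rfl⟩
        · have := hlin hP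
          simp [Fin.sum_univ_succ]
          linear_combination this
    · by_cases h5 : a₅ = 0
      · subst h5
        have : S.card ≤ 4 := by
          refine card_le_of_graph (c := ![a₀ ^ 2 - a₂ ^ 2 * b, 2 * a₀ * a₁, a₁ ^ 2 + 2 * a₀ * a₃,
            2 * a₁ * a₃ - a₂ ^ 2, a₃ ^ 2]) ?_ (fun x => a₀ + a₁ * x + a₃ * x ^ 2) (fun _ => a₂)
            (fun _ _ => h2) (fun P hP => ?_) fun P hP => ?_
          · intro h
            have h3 := congrFun h 3
            have h4 := congrFun h 4
            simp at h3 h4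
            simp [h4] at h3
            exact h2 h3
          · linear_combination hlin hP
          · have h := hcurve hP
            have h' := hlin hP
            simp [Fin.sum_univ_succ]
            linear_combination (a₀ + a₁ * P.1 + a₃ * P.1 ^ 2 - a₂ * P.2) * h' + a₂ ^ 2 * h
        exact ⟨by omega, fun _ => by omega⟩
      · refine ⟨?_, fun h => absurd h h5⟩
        refine card_le_of_graph (c := ![(a₀ + a₅ * b) ^ 2 - a₂ ^ 2 * b, 2 * (a₀ + a₅ * b) * a₁,
          a₁ ^ 2 + 2 * (a₀ + a₅ * b) * a₃, 2 * (a₀ + a₅ * b) * a₅ + 2 * a₁ * a₃ - a₂ ^ 2,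
          a₃ ^ 2 + 2 * a₁ * a₅, 2 * a₃ * a₅, a₅ ^ 2]) ?_
          (fun x => a₀ + a₅ * b + a₁ * x + a₃ * x ^ 2 + a₅ * x ^ 3) (fun _ => a₂)
          (fun _ _ => h2) (fun P hP => ?_) fun P hP => ?_
        · intro h
          have h6 := congrFun h 6
          simp at h6
          exact h5 h6
        · linear_combination hlin hP
        · have h := hcurve hP
          have h' := hlin hP
          simp [Fin.sum_univ_succ]
          linear_combination (a₀ + a₅ * b + a₁ * P.1 + a₃ * P.1 ^ 2 + a₅ * P.1 ^ 3 - a₂ * P.2) * h'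
            + a₂ ^ 2 * h
  · obtain ⟨ξ, hξ⟩ : ∃ ξ, a₂ = -(a₄ * ξ) := ⟨-a₂ / a₄, by field_simp⟩
    subst hξ
    by_cases hp : a₀ + a₅ * b + a₁ * ξ + a₃ * ξ ^ 2 + a₅ * ξ ^ 3 = 0
    · have hsplit := card_filter_add_card_filter_not (s := S) (fun P => P.1 = ξ)
      have hfib : (S.filter fun P => P.1 = ξ).card ≤ 2 :=
        (card_le_card (filter_subset_filter _ hSb)).trans (card_affPts_fiber_le b ξ)
      have hquot {P : F × F} (hP : P ∈ S.filter fun P => ¬ P.1 = ξ) :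
          (a₁ + a₃ * ξ + a₅ * ξ ^ 2 + (a₃ + a₅ * ξ) * P.1 + a₅ * P.1 ^ 2) + a₄ * P.2 = 0 := by
        rw [mem_filter] at hP
        refine mul_left_cancel₀ (sub_ne_zero.mpr hP.2) ?_
        linear_combination hlin hP.1 - hp
      by_cases h5 : a₅ = 0
      · subst h5
        have : (S.filter fun P => ¬ P.1 = ξ).card ≤ 3 := by
          refine card_le_of_graph (c := ![(a₁ + a₃ * ξ) ^ 2 - a₄ ^ 2 * b,
            2 * (a₁ + a₃ * ξ) * a₃, a₃ ^ 2, -a₄ ^ 2]) ?_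
            (fun x => a₁ + a₃ * ξ + a₃ * x) (fun _ => a₄)
            (fun _ _ => h4) (fun P hP => ?_) fun P hP => ?_
          · intro h
            have h3 := congrFun h 3
            simp at h3
            exact h4 h3
          · linear_combination hquot hP
          · have h' := hquot hP
            have h := hcurve (mem_filter.mp hP).1
            simp [Fin.sum_univ_succ]
            linear_combination (a₁ + a₃ * ξ + a₃ * P.1 - a₄ * P.2) * h' + a₄ ^ 2 * h
        exact ⟨by omega, fun _ => by omega⟩
      · refine ⟨?_, fun h => absurd h h5⟩
        have : (S.filter fun P => ¬ P.1 = ξ).card ≤ 4 := by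
          refine card_le_of_graph (c := ![(a₁ + a₃ * ξ + a₅ * ξ ^ 2) ^ 2 - a₄ ^ 2 * b,
            2 * (a₁ + a₃ * ξ + a₅ * ξ ^ 2) * (a₃ + a₅ * ξ),
            (a₃ + a₅ * ξ) ^ 2 + 2 * a₅ * (a₁ + a₃ * ξ + a₅ * ξ ^ 2),
            2 * a₅ * (a₃ + a₅ * ξ) - a₄ ^ 2, a₅ ^ 2]) ?_
            (fun x => a₁ + a₃ * ξ + a₅ * ξ ^ 2 + (a₃ + a₅ * ξ) * x + a₅ * x ^ 2) (fun _ => a₄)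
            (fun _ _ => h4) (fun P hP => hquot hP) fun P hP => ?_
          · intro h
            have h3 := congrFun h 4
            simp at h3
            exact h5 h3
          · have h' := hquot hP
            have h := hcurve (mem_filter.mp hP).1
            simp [Fin.sum_univ_succ]
            linear_combination (a₁ + a₃ * ξ + a₅ * ξ ^ 2 + (a₃ + a₅ * ξ) * P.1 + a₅ * P.1 ^ 2
              - a₄ * P.2) * h' + a₄ ^ 2 * h
        omega
    · have hne {P : F × F} (hP : P ∈ S) : -(a₄ * ξ) + a₄ * P.1 ≠ 0 := by
        intro h
        have h' := hlin hP
        rw [h] at h'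
        have : P.1 = ξ := mul_left_cancel₀ h4 (by linear_combination h)
        rw [this] at h'
        exact hp (by linear_combination h')
      by_cases h5 : a₅ = 0
      · subst h5
        have : S.card ≤ 5 := by
          refine card_le_of_graph (c := ![a₀ ^ 2 - (a₄ * ξ) ^ 2 * b,
            2 * a₀ * a₁ + 2 * a₄ ^ 2 * ξ * b, a₁ ^ 2 + 2 * a₀ * a₃ - a₄ ^ 2 * b,
            2 * a₁ * a₃ - (a₄ * ξ) ^ 2, a₃ ^ 2 + 2 * a₄ ^ 2 * ξ, -a₄ ^ 2]) ?_
            (fun x => a₀ + a₁ * x + a₃ * x ^ 2) (fun x => -(a₄ * ξ) + a₄ * x)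
            (fun P hP => hne hP) (fun P hP => ?_) fun P hP => ?_
          · intro h
            have h3 := congrFun h 5
            simp at h3
            exact h4 h3
          · linear_combination hlin hP
          · have h' := hlin hP
            have h := hcurve hP
            simp [Fin.sum_univ_succ]
            linear_combination (a₀ + a₁ * P.1 + a₃ * P.1 ^ 2
              - (-(a₄ * ξ) + a₄ * P.1) * P.2) * h' + (-(a₄ * ξ) + a₄ * P.1) ^ 2 * h
        exact ⟨by omega, fun _ => by omega⟩
      · refine ⟨?_, fun h => absurd h h5⟩
        refine card_le_of_graph (c := ![(a₀ + a₅ * b) ^ 2 - (a₄ * ξ) ^ 2 * b,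
            2 * (a₀ + a₅ * b) * a₁ + 2 * a₄ ^ 2 * ξ * b,
            a₁ ^ 2 + 2 * (a₀ + a₅ * b) * a₃ - a₄ ^ 2 * b,
            2 * (a₀ + a₅ * b) * a₅ + 2 * a₁ * a₃ - (a₄ * ξ) ^ 2,
            a₃ ^ 2 + 2 * a₁ * a₅ + 2 * a₄ ^ 2 * ξ, 2 * a₃ * a₅ - a₄ ^ 2, a₅ ^ 2]) ?_
            (fun x => a₀ + a₅ * b + a₁ * x + a₃ * x ^ 2 + a₅ * x ^ 3) (fun x => -(a₄ * ξ) + a₄ * x)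
            (fun P hP => hne hP) (fun P hP => hlin hP) fun P hP => ?_
        · intro h
          have h3 := congrFun h 6
          simp at h3
          exact h5 h3
        · have h' := hlin hP
          have h := hcurve hP
          simp [Fin.sum_univ_succ]
          linear_combination (a₀ + a₅ * b + a₁ * P.1 + a₃ * P.1 ^ 2 + a₅ * P.1 ^ 3
            - (-(a₄ * ξ) + a₄ * P.1) * P.2) * h' + (-(a₄ * ξ) + a₄ * P.1) ^ 2 * h

/-- A conic meets the curve in at most six points. -/
lemma card_conicZeros_le {b : F} {a : Fin 6 → F} (ha : a ≠ 0) : (conicZeros b a).card ≤ 6 := by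
  have hle := card_le_card_eraseNone_add_one (conicZeros b a)
  obtain ⟨h6, h5⟩ : (conicZeros b a).eraseNone.card ≤ 6 ∧
      (a 5 = 0 → (conicZeros b a).eraseNone.card ≤ 5) := by
    refine card_affine_conicZeros_le (b := b) (a₀ := a 0) (a₁ := a 1) (a₂ := a 2) (a₃ := a 3)
      (a₄ := a 4) ?_ (fun P hP => ?_) fun P hP => ?_
    · rintro ⟨h0, h1, h2, h3, h4, h5⟩
      refine ha (funext fun i => ?_)
      fin_cases i
      exacts [h0, h1, h2, h3, h4, h5]
    · rw [mem_eraseNone, some_mem_conicZeros] at hP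
      simpa [affPts] using hP.1
    · rw [mem_eraseNone, some_mem_conicZeros] at hP
      exact hP.2
  simp only [none_mem_conicZeros] at hle
  split_ifs at hle with h
  · have := h5 h
    omega
  · omega

section

/-- The conic consisting of the lines `l` and `m`. -/
def lineMul (l m : Fin 3 → F) : Fin 6 → F :=
  ![l 0 * m 0, l 0 * m 1 + l 1 * m 0, l 0 * m 2 + l 2 * m 0, l 1 * m 1, l 1 * m 2 + l 2 * m 1,
    l 2 * m 2]

lemma lineMul_dotProduct (l m : Fin 3 → F) (u : Fin 6 → F) :
    lineMul l m ⬝ᵥ u = l 0 * m 0 * u 0 + (l 0 * m 1 + l 1 * m 0) * u 1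
      + (l 0 * m 2 + l 2 * m 0) * u 2 + l 1 * m 1 * u 3 + (l 1 * m 2 + l 2 * m 1) * u 4
      + l 2 * m 2 * u 5 := by
  simp [lineMul, dotProduct, Fin.sum_univ_six]

lemma lineMul_dotProduct_conicVec (l m : Fin 3 → F) (P : Option (F × F)) :
    lineMul l m ⬝ᵥ conicVec P = (l ⬝ᵥ planeVec P) * (m ⬝ᵥ planeVec P) := by
  rw [lineMul_dotProduct]
  cases P with
  | none => simp [dotProduct_planeVec_none, conicVec]
  | some P =>
    rw [dotProduct_planeVec_some, dotProduct_planeVec_some]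
    simp [conicVec]
    ring

lemma lineMul_ne_zero {l m : Fin 3 → F} (hl : l ≠ 0) (hm : m ≠ 0) : lineMul l m ≠ 0 := by
  intro h
  have h0 := congrFun h 0
  have h1 := congrFun h 1
  have h2 := congrFun h 2
  have h3 := congrFun h 3
  have h4 := congrFun h 4
  have h5 := congrFun h 5
  simp [lineMul] at h0 h1 h2 h3 h4 h5
  have hl' : ¬ (l 0 = 0 ∧ l 1 = 0 ∧ l 2 = 0) := fun ⟨a, b, c⟩ => hl <| funext fun i => by
    fin_cases i
    exacts [a, b, c]
  have hm' : ¬ (m 0 = 0 ∧ m 1 = 0 ∧ m 2 = 0) := fun ⟨a, b, c⟩ => hm <| funext fun i => by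
    fin_cases i
    exacts [a, b, c]
  grind

lemma planeVec_ne_zero (P : Option (F × F)) : planeVec P ≠ 0 := by
  intro h
  cases P with
  | none => simpa [planeVec] using congrFun h 2
  | some P => simpa [planeVec] using congrFun h 0

variable {b : F}

/-- A quadratic form vanishing on enough members of a pencil vanishes on the whole pencil. -/
lemma IsRichPencil.lineMul_self_eq_zero (h2 : (2 : F) ≠ 0) {u : Fin 6 → F}
    (hu : ∀ l : Fin 3 → F, l ≠ 0 → 3 ≤ (lineZeros b l).card → lineMul l l ⬝ᵥ u = 0)
    {w v₀ v₁ : Fin 3 → F} (hR : IsRichPencil b w v₀ v₁) {l : Fin 3 → F} (hl : l ⬝ᵥ w = 0) :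
    lineMul l l ⬝ᵥ u = 0 := by
  have hc : (![lineMul v₀ v₀ ⬝ᵥ u, 2 * (lineMul v₀ v₁ ⬝ᵥ u), lineMul v₁ v₁ ⬝ᵥ u] :
      Fin (2 + 1) → F) = 0 := by
    by_contra hc
    have hle := card_filter_sum_mul_pow_eq_zero_le hc
    have hsub := card_le_card (s := univ.filter fun t : F => 3 ≤ (lineZeros b (v₀ + t • v₁)).card)
      (t := univ.filter fun t : F => ∑ i, (![lineMul v₀ v₀ ⬝ᵥ u, 2 * (lineMul v₀ v₁ ⬝ᵥ u),
        lineMul v₁ v₁ ⬝ᵥ u] : Fin (2 + 1) → F) i * t ^ (i : ℕ) = 0) fun t ht => by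
          simp only [mem_filter, mem_univ, true_and] at ht ⊢
          rw [← hu _ (hR.ne_zero t) ht]
          simp [Fin.sum_univ_succ, lineMul_dotProduct]
          ring
    exact absurd (hR.many.trans (hsub.trans hle)) (by norm_num)
  have h00 := congrFun hc 0
  have h01 := congrFun hc 1
  have h11 := congrFun hc 2
  simp [h2] at h00 h01 h11
  obtain ⟨x, y, rfl⟩ := hR.span l hl
  have : lineMul (x • v₀ + y • v₁) (x • v₀ + y • v₁) ⬝ᵥ u = x ^ 2 * (lineMul v₀ v₀ ⬝ᵥ u)
      + 2 * x * y * (lineMul v₀ v₁ ⬝ᵥ u) + y ^ 2 * (lineMul v₁ v₁ ⬝ᵥ u) := by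
    simp [lineMul_dotProduct]
    ring
  simp [this, h00, h01, h11]

/-- At most one member of a pencil passes through a point of a line outside the pencil. -/
lemma IsRichPencil.card_through_le {w v₀ v₁ l : Fin 3 → F} (hR : IsRichPencil b w v₀ v₁)
    (hl : l ⬝ᵥ w ≠ 0) {P : Option (F × F)} (hP : l ⬝ᵥ planeVec P = 0) :
    (univ.filter fun t : F => (v₀ + t • v₁) ⬝ᵥ planeVec P = 0).card ≤ 1 := by
  refine card_le_one.mpr fun t ht t' ht' => ?_
  simp only [mem_filter, mem_univ, true_and, add_dotProduct, smul_dotProduct, smul_eq_mul] at ht ht'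
  by_contra hne
  have h1 : v₁ ⬝ᵥ planeVec P = 0 :=
    mul_left_cancel₀ (sub_ne_zero.mpr hne) (by linear_combination ht - ht')
  have h0 : v₀ ⬝ᵥ planeVec P = 0 := by simpa [h1] using ht
  refine planeVec_ne_zero P (dotProduct_eq_zero _ fun m => ?_)
  rw [dotProduct_comm]
  obtain ⟨x, y, hxy⟩ := hR.span (m - ((m ⬝ᵥ w) / (l ⬝ᵥ w)) • l) (by
    simp [sub_dotProduct, div_mul_cancel₀ _ hl])
  have := congrArg (· ⬝ᵥ planeVec P) hxy
  simpa [sub_dotProduct, add_dotProduct, h0, h1, hP] using this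

/-- Through every point of the plane there is a three-secant of the curve. -/
lemma exists_three_le_card_lineZeros
    (h2 : (2 : F) ≠ 0) (h3 : (3 : F) ≠ 0) (hm3 : IsSquare (-3 : F)) (hb : b ≠ 0)
    (hA : 3 * Fintype.card F + 400 ≤ 4 * (affPts b).card) (u : Fin 3 → F) :
    ∃ l : Fin 3 → F, l ≠ 0 ∧ l ⬝ᵥ u = 0 ∧ 3 ≤ (lineZeros b l).card := by
  wlog hu : u ≠ 0 generalizing u
  · obtain ⟨l, hl, -, h⟩ := this ![1, 0, 0] fun h => by simpa using congrFun h 0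
    exact ⟨l, hl, by simp [not_not.mp hu], h⟩
  obtain ⟨v₀, v₁, hR⟩ := exists_isRichPencil h2 h3 hm3 hb hA hu
  obtain ⟨t, ht⟩ := card_pos.mp (lt_of_lt_of_le (by norm_num) hR.many)
  refine ⟨v₀ + t • v₁, hR.ne_zero t, ?_, (mem_filter.mp ht).2⟩
  simp [add_dotProduct, hR.left, hR.right]

/-- Some three-secant of the curve is not isotropic for a given nonzero quadratic form. -/
lemma exists_lineMul_self_ne_zero
    (h2 : (2 : F) ≠ 0) (h3 : (3 : F) ≠ 0) (hm3 : IsSquare (-3 : F)) (hb : b ≠ 0)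
    (hA : 3 * Fintype.card F + 400 ≤ 4 * (affPts b).card) {u : Fin 6 → F} (hu : u ≠ 0) :
    ∃ l : Fin 3 → F, l ≠ 0 ∧ 3 ≤ (lineZeros b l).card ∧ lineMul l l ⬝ᵥ u ≠ 0 := by
  by_contra! hcon
  have key (k : Fin 3) {l : Fin 3 → F} (hl : l k = 0) : lineMul l l ⬝ᵥ u = 0 := by
    obtain ⟨v₀, v₁, hR⟩ := exists_isRichPencil h2 h3 hm3 hb hA (w := Pi.single k 1)
      fun h => by simpa using congrFun h k
    exact hR.lineMul_self_eq_zero h2 hcon (by simpa using hl)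
  have h100 := key 1 (l := ![1, 0, 0]) rfl
  have h010 := key 0 (l := ![0, 1, 0]) rfl
  have h001 := key 0 (l := ![0, 0, 1]) rfl
  have h110 := key 2 (l := ![1, 1, 0]) rfl
  have h101 := key 1 (l := ![1, 0, 1]) rfl
  have h011 := key 0 (l := ![0, 1, 1]) rfl
  simp [lineMul_dotProduct] at h100 h010 h001 h110 h101 h011
  refine hu (funext fun i => ?_)
  fin_cases i
  · exact h100
  · exact (mul_eq_zero.mp (show 2 * u 1 = 0 by linear_combination h110 - h100 - h010)).resolve_left h2
  · exact (mul_eq_zero.mp (show 2 * u 2 = 0 by linear_combination h101 - h100 - h001)).resolve_left h2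
  · exact h010
  · exact (mul_eq_zero.mp (show 2 * u 4 = 0 by linear_combination h011 - h010 - h001)).resolve_left h2
  · exact h001

/-- Every linear condition on conics is satisfied by a conic meeting the curve in six points. -/
lemma exists_six_le_card_conicZeros
    (h2 : (2 : F) ≠ 0) (h3 : (3 : F) ≠ 0) (hm3 : IsSquare (-3 : F)) (hb : b ≠ 0)
    (hA : 3 * Fintype.card F + 400 ≤ 4 * (affPts b).card) (u : Fin 6 → F) :
    ∃ a : Fin 6 → F, a ≠ 0 ∧ a ⬝ᵥ u = 0 ∧ 6 ≤ (conicZeros b a).card := by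
  wlog hu : u ≠ 0 generalizing u
  · obtain ⟨l, hl, -, h⟩ := this ![1, 0, 0, 0, 0, 0] fun h => by simpa using congrFun h 0
    exact ⟨l, hl, by simp [not_not.mp hu], h⟩
  obtain ⟨l, hl, hl3, hlu⟩ := exists_lineMul_self_ne_zero h2 h3 hm3 hb hA hu
  obtain ⟨w, hw⟩ : ∃ w : Fin 3 → F, ∀ m, m ⬝ᵥ w = lineMul l m ⬝ᵥ u := by
    refine ⟨![l 0 * u 0 + l 1 * u 1 + l 2 * u 2, l 0 * u 1 + l 1 * u 3 + l 2 * u 4,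
      l 0 * u 2 + l 1 * u 4 + l 2 * u 5], fun m => ?_⟩
    rw [lineMul_dotProduct]
    simp [dotProduct, Fin.sum_univ_three]
    ring
  have hlw : l ⬝ᵥ w ≠ 0 := by rwa [hw]
  have hw0 : w ≠ 0 := by
    rintro rfl
    simp at hlw
  obtain ⟨v₀, v₁, hR⟩ := exists_isRichPencil h2 h3 hm3 hb hA hw0
  have hbad : ((lineZeros b l).biUnion fun P =>
      univ.filter fun t : F => (v₀ + t • v₁) ⬝ᵥ planeVec P = 0).card ≤ 3 := by
    refine (card_biUnion_le_card_mul _ _ 1 fun P hP => ?_).trans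
      (by simpa using card_lineZeros_le hl)
    exact hR.card_through_le hlw (mem_filter.mp hP).2
  obtain ⟨t, ht, htbad⟩ := exists_mem_notMem_of_card_lt_card
    (lt_of_le_of_lt hbad (lt_of_lt_of_le (by norm_num) hR.many))
  rw [mem_filter] at ht
  simp only [mem_biUnion, mem_filter, mem_univ, true_and, not_exists, not_and] at htbad
  refine ⟨lineMul l (v₀ + t • v₁), lineMul_ne_zero hl (hR.ne_zero t), ?_, ?_⟩
  · rw [← hw]
    simp [add_dotProduct, hR.left, hR.right]
  · have hdisj : Disjoint (lineZeros b l) (lineZeros b (v₀ + t • v₁)) :=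
      disjoint_left.mpr fun P hP hP' => htbad P hP (mem_filter.mp hP').2
    have hsub : lineZeros b l ∪ lineZeros b (v₀ + t • v₁)
        ⊆ conicZeros b (lineMul l (v₀ + t • v₁)) := by
      intro P hP
      simp only [mem_union, lineZeros, mem_filter] at hP
      simp only [conicZeros, mem_filter, lineMul_dotProduct_conicVec, mul_eq_zero]
      tauto
    have := card_le_card hsub
    rw [card_union_of_disjoint hdisj] at this
    omega

end

lemma hammingNorm_add_card_eq_zero {n : ℕ} (x : Fin n → F) :
    hammingNorm x + (univ.filter fun j => x j = 0).card = n := by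
  have := card_filter_add_card_filter_not (s := (univ : Finset (Fin n))) (fun j => x j = 0)
  rw [card_univ, Fintype.card_fin] at this
  rw [hammingNorm, add_comm]
  exact this

/-- A code whose nonzero words have at most `k` zeros is not extendable if every linear functional
on the message space vanishes on a nonzero message whose codeword has at least `k` zeros. -/
lemma not_isHExtendable_one {n k : ℕ} (φ : Fin n → Fin k → F) (hkn : k < n)
    (hle : ∀ a : Fin k → F, a ≠ 0 → (univ.filter fun j => a ⬝ᵥ φ j = 0).card ≤ k)
    (hge : ∀ u : Fin k → F, ∃ a : Fin k → F, a ≠ 0 ∧ a ⬝ᵥ u = 0 ∧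
      k ≤ (univ.filter fun j => a ⬝ᵥ φ j = 0).card) :
    ¬ IsHExtendable 1
      (Submodule.span F (Set.range fun i : Fin k => fun j : Fin n => φ j i)) := by
  rintro ⟨C', -, hd, hmap⟩
  set C := Submodule.span F (Set.range fun i : Fin k => fun j : Fin n => φ j i) with hC
  have hmem (a : Fin k → F) : (fun j => a ⬝ᵥ φ j) ∈ C := by
    have : (fun j => a ⬝ᵥ φ j) = ∑ i, a i • fun j => φ j i := by
      ext j
      simp [dotProduct]
    rw [this]
    exact Submodule.sum_mem _ fun i _ =>
      Submodule.smul_mem _ _ (Submodule.subset_span (Set.mem_range_self i))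
  have hmem' {x : Fin n → F} (hx : x ∈ C) : ∃ a : Fin k → F, x = fun j => a ⬝ᵥ φ j := by
    obtain ⟨a, ha⟩ := (Submodule.mem_span_range_iff_exists_fun F).mp hx
    refine ⟨a, ?_⟩
    rw [← ha]
    ext j
    simp [dotProduct]
  have hne {a : Fin k → F} (ha : a ≠ 0) : (fun j => a ⬝ᵥ φ j) ≠ 0 := by
    intro h
    have h1 := hle a ha
    have h2 : (univ.filter fun j => a ⬝ᵥ φ j = 0) = univ :=
      filter_true_of_mem fun j _ => congrFun h j
    rw [h2, card_univ, Fintype.card_fin] at h1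
    omega
  have hlow : n - k ≤ minDist C := by
    obtain ⟨a, ha, -⟩ := hge 0
    refine le_csInf ⟨_, _, hmem a, hne ha, rfl⟩ ?_
    rintro d ⟨x, hx, hx0, rfl⟩
    obtain ⟨a, rfl⟩ := hmem' hx
    have ha : a ≠ 0 := by
      rintro rfl
      exact hx0 (funext fun j => by simp)
    have := hammingNorm_add_card_eq_zero fun j => a ⬝ᵥ φ j
    have := hle a ha
    omega
  have hlift (i : Fin k) : ∃ y ∈ C', ∀ j, y (Fin.castAdd 1 j) = φ j i := by
    have : (fun j => φ j i) ∈ C := Submodule.subset_span (Set.mem_range_self i)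
    rw [← hmap] at this
    obtain ⟨y, hy, h⟩ := this
    exact ⟨y, hy, fun j => congrFun h j⟩
  choose y hy hyφ using hlift
  obtain ⟨a, ha, hau, hk⟩ := hge fun i => y i (Fin.last n)
  set z : Fin (n + 1) → F := ∑ i, a i • y i with hz
  have hzC : z ∈ C' := Submodule.sum_mem _ fun i _ => Submodule.smul_mem _ _ (hy i)
  have hzcast (j : Fin n) : z (Fin.castAdd 1 j) = a ⬝ᵥ φ j := by
    simp [hz, dotProduct, hyφ]
  have hzlast : z (Fin.last n) = 0 := by
    rw [← hau]
    simp [hz, dotProduct]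
  have hz0 : z ≠ 0 := by
    intro h
    refine hne ha (funext fun j => ?_)
    rw [← hzcast, h]
    rfl
  have hnorm : hammingNorm z = hammingNorm fun j => a ⬝ᵥ φ j := by
    have h1 : ∀ {m : ℕ} (x : Fin m → F), hammingNorm x = ∑ j, if x j ≠ 0 then 1 else 0 := by
      intro m x
      rw [hammingNorm, card_filter]
    rw [h1, h1, Fin.sum_univ_castSucc]
    simp only [hzlast, ne_eq, not_true_eq_false, if_false, add_zero]
    exact sum_congr rfl fun j _ => by rw [← hzcast]; rfl
  have hup : minDist C' ≤ hammingNorm z := Nat.sInf_le ⟨z, hzC, hz0, rfl⟩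
  have := hammingNorm_add_card_eq_zero fun j => a ⬝ᵥ φ j
  omega

/-- Non-extendability of an elliptic code, checked on a model `v` of the point set given by a
parametrization `θ` of the curve `y² = x³ + b`. -/
lemma not_isHExtendable_ellipticCode {W : WeierstrassCurve F} {k n : ℕ}
    (e : Fin n ≃ W.toAffine.Point) (hkn : k < n) {b : F}
    {θ : W.toAffine.Point → Option (F × F)} (hθ : Function.Injective θ)
    (himg : ∀ P, P ∈ curvePts b ↔ ∃ Q, θ Q = P) (v : Option (F × F) → Fin k → F)
    (M : Matrix (Fin k) (Fin k) F) (hM : IsUnit M.det) (hv : ∀ P, phiVec W k P = M *ᵥ v (θ P))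
    (hle : ∀ a : Fin k → F, a ≠ 0 → ((curvePts b).filter fun P => a ⬝ᵥ v P = 0).card ≤ k)
    (hge : ∀ u : Fin k → F, ∃ a : Fin k → F, a ≠ 0 ∧ a ⬝ᵥ u = 0 ∧
      k ≤ ((curvePts b).filter fun P => a ⬝ᵥ v P = 0).card) :
    ¬ IsHExtendable 1 (ellipticCode W k e) := by
  have hcard (a : Fin k → F) : (univ.filter fun j => a ⬝ᵥ phiVec W k (e j) = 0).card
      = ((curvePts b).filter fun P => (a ᵥ* M) ⬝ᵥ v P = 0).card := by
    refine card_nbij (fun j => θ (e j)) (fun j hj => ?_) (fun i _ j _ h => e.injective (hθ h)) ?_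
    · simp only [coe_filter, mem_univ, true_and, Set.mem_ofPred_eq] at hj ⊢
      rw [hv, dotProduct_mulVec] at hj
      exact ⟨(himg _).mpr ⟨_, rfl⟩, hj⟩
    · intro P hP
      simp only [coe_filter, Set.mem_ofPred_eq] at hP
      obtain ⟨Q, rfl⟩ := (himg P).mp hP.1
      refine ⟨e.symm Q, ?_, by simp⟩
      simpa [hv, dotProduct_mulVec] using hP.2
  refine not_isHExtendable_one (fun j => phiVec W k (e j)) hkn (fun a ha => ?_) fun u => ?_
  · rw [hcard]
    refine hle _ fun h => ha ?_
    have := congrArg (· ᵥ* M⁻¹) h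
    simpa [vecMul_vecMul, mul_nonsing_inv _ hM] using this
  · obtain ⟨a, ha, hau, hk⟩ := hge (M⁻¹ *ᵥ u)
    refine ⟨a ᵥ* M⁻¹, fun h => ha ?_, by rwa [← dotProduct_mulVec], ?_⟩
    · have := congrArg (· ᵥ* M) h
      simpa [vecMul_vecMul, nonsing_inv_mul _ hM] using this
    · rwa [hcard, vecMul_vecMul, nonsing_inv_mul _ hM, vecMul_one]

/-- Completing the square and the cube. -/
def shortPoint (W : WeierstrassCurve F) (c d f : F) : W.toAffine.Point → Option (F × F)
  | .zero => none
  | .some x y _ => some (x + d, y + c * x + f)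

lemma shortPoint_injective (W : WeierstrassCurve F) (c d f : F) :
    Function.Injective (shortPoint W c d f) := by
  rintro (_ | ⟨x, y, h⟩) (_ | ⟨x', y', h'⟩) heq
  · rfl
  · simp [shortPoint] at heq
  · simp [shortPoint] at heq
  · simp only [shortPoint, Option.some.injEq, Prod.mk.injEq] at heq
    obtain rfl : x = x' := add_right_cancel heq.1
    obtain rfl : y = y' := by linear_combination heq.2
    rfl

lemma mem_curvePts_iff_exists_shortPoint (W : WeierstrassCurve F) [W.IsElliptic] {b c d f : F}
    (h₁ : W.a₁ = 2 * c) (h₂ : W.a₂ = 3 * d - c ^ 2) (h₃ : W.a₃ = 2 * f)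
    (h₄ : W.a₄ = 3 * d ^ 2 - 2 * c * f) (h₆ : W.a₆ = b + d ^ 3 - f ^ 2) (P : Option (F × F)) :
    P ∈ curvePts b ↔ ∃ Q, shortPoint W c d f Q = P := by
  have hcurve (x y : F) :
      W.toAffine.Equation x y ↔ (y + c * x + f) ^ 2 = (x + d) ^ 3 + b := by
    rw [Affine.equation_iff, h₁, h₂, h₃, h₄, h₆]
    constructor <;> intro h <;> linear_combination h
  cases P with
  | none => exact ⟨fun _ => ⟨.zero, rfl⟩, fun _ => by simp [curvePts]⟩
  | some P =>
    obtain ⟨x, y⟩ := P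
    simp only [curvePts, some_mem_insertNone, affPts, mem_filter, mem_univ, true_and]
    constructor
    · intro h
      have hE : W.toAffine.Equation (x - d) (y - c * (x - d) - f) := by
        rw [hcurve]
        linear_combination h
      exact ⟨.some _ _ (Affine.equation_iff_nonsingular.mp hE), by
        simp only [shortPoint, sub_add_cancel, Option.some.injEq, Prod.mk.injEq, true_and]
        ring⟩
    · rintro ⟨_ | ⟨x', y', h⟩, hQ⟩
      · simp [shortPoint] at hQ
      · simp only [shortPoint, Option.some.injEq, Prod.mk.injEq] at hQ
        rw [← hQ.1, ← hQ.2, ← hcurve]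
        exact Affine.equation_iff_nonsingular.mpr h

/-- An elliptic curve with `j = 0` in characteristic different from `2` and `3` is a translate of
`y² = x³ + b`. -/
lemma exists_short_coeffs (W : WeierstrassCurve F) [W.IsElliptic] (hj : W.j = 0)
    (h2 : (2 : F) ≠ 0) (h3 : (3 : F) ≠ 0) : ∃ b c d f : F, b ≠ 0 ∧ W.a₁ = 2 * c ∧
      W.a₂ = 3 * d - c ^ 2 ∧ W.a₃ = 2 * f ∧ W.a₄ = 3 * d ^ 2 - 2 * c * f ∧
      W.a₆ = b + d ^ 3 - f ^ 2 := by
  obtain ⟨c, h₁⟩ : ∃ c, W.a₁ = 2 * c := ⟨W.a₁ / 2, by field_simp⟩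
  obtain ⟨f, h₃⟩ : ∃ f, W.a₃ = 2 * f := ⟨W.a₃ / 2, by field_simp⟩
  obtain ⟨d, h₂⟩ : ∃ d, W.a₂ = 3 * d - c ^ 2 := ⟨(W.a₂ + c ^ 2) / 3, by field_simp; ring⟩
  obtain ⟨b, h₆⟩ : ∃ b, W.a₆ = b + d ^ 3 - f ^ 2 := ⟨W.a₆ - d ^ 3 + f ^ 2, by ring⟩
  have hc₄ := W.j_eq_zero_iff.mp hj
  have h₄ : W.a₄ = 3 * d ^ 2 - 2 * c * f := by
    have h48 : (48 : F) ≠ 0 := by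
      have : (48 : F) = 2 ^ 4 * 3 := by norm_num
      rw [this]
      exact mul_ne_zero (pow_ne_zero _ h2) h3
    refine mul_left_cancel₀ h48 ?_
    simp only [c₄, b₂, b₄, h₁, h₂, h₃] at hc₄
    linear_combination -hc₄
  refine ⟨b, c, d, f, ?_, h₁, h₂, h₃, h₄, h₆⟩
  rintro rfl
  refine W.isUnit_Δ.ne_zero ?_
  simp only [WeierstrassCurve.Δ, b₂, b₄, b₆, b₈, h₁, h₂, h₃, h₄, h₆]
  ring

/-- The coordinate change on the plane inverse to `shortPoint`. -/
def lineChange (c d g : F) : Matrix (Fin 3) (Fin 3) F :=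
  !![1, 0, 0; -d, 1, 0; g, -c, 1]

/-- The action of `lineChange` on the monomials of degree two. -/
def conicChange (c d g : F) : Matrix (Fin 6) (Fin 6) F :=
  !![1, 0, 0, 0, 0, 0;
     -d, 1, 0, 0, 0, 0;
     g, -c, 1, 0, 0, 0;
     d ^ 2, -2 * d, 0, 1, 0, 0;
     -d * g, g + d * c, -d, -c, 1, 0;
     g ^ 2, -2 * c * g, 2 * g, c ^ 2, -2 * c, 1]

lemma det_lineChange (c d g : F) : (lineChange c d g).det = 1 := by
  rw [det_of_isLowerTriangular]
  · simp [lineChange, Fin.prod_univ_succ]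
  · intro i j hij
    fin_cases i <;> fin_cases j <;> first | rfl | exact absurd hij (by decide)

lemma det_conicChange (c d g : F) : (conicChange c d g).det = 1 := by
  rw [det_of_isLowerTriangular]
  · simp [conicChange, Fin.prod_univ_succ]
  · intro i j hij
    fin_cases i <;> fin_cases j <;> first | rfl | exact absurd hij (by decide)

lemma phiVec_three (W : WeierstrassCurve F) (c d f : F) (P : W.toAffine.Point) :
    phiVec W 3 P = lineChange c d (c * d - f) *ᵥ planeVec (shortPoint W c d f P) := by
  rcases P with _ | ⟨x, y, h⟩ <;> ext i <;> fin_cases i <;>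
    simp [phiVec, psi, shortPoint, planeVec, lineChange, mulVec, dotProduct, Fin.sum_univ_succ]
  ring

lemma phiVec_six (W : WeierstrassCurve F) (c d f : F) (P : W.toAffine.Point) :
    phiVec W 6 P = conicChange c d (c * d - f) *ᵥ conicVec (shortPoint W c d f P) := by
  rcases P with _ | ⟨x, y, h⟩ <;> ext i <;> fin_cases i <;>
    simp [phiVec, psi, shortPoint, conicVec, conicChange, mulVec, dotProduct,
      Fin.sum_univ_succ] <;>
    ring

lemma natCast_ne_zero_of_coprime {p r m : ℕ} (hcard : Fintype.card F = p ^ r)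
    (hm : m.Coprime p) : (m : F) ≠ 0 := by
  intro h
  have hp : (p : F) = 0 := by
    have := FiniteField.cast_card_eq_zero F
    rw [hcard, Nat.cast_pow] at this
    exact eq_zero_of_pow_eq_zero this
  obtain ⟨x, y, hxy⟩ := Nat.isCoprime_iff_coprime.mpr hm
  have := congrArg (Int.cast : ℤ → F) hxy
  simp [h, hp] at this

lemma isSquare_neg_three (hq : Fintype.card F % 3 = 1) : IsSquare (-3 : F) := by
  have : Fact (Nat.Prime 3) := ⟨Nat.prime_three⟩
  have hdvd : 3 ∣ Fintype.card Fˣ := by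
    rw [Fintype.card_units]
    omega
  obtain ⟨ζ, hζ⟩ := exists_prime_orderOf_dvd_card 3 hdvd
  have h3 : (ζ : F) ^ 3 = 1 := by
    rw [← Units.val_pow_eq_pow_val, ← hζ, pow_orderOf_eq_one, Units.val_one]
  have h1 : (ζ : F) ≠ 1 := by
    intro h
    rw [Units.val_eq_one] at h
    simp [h] at hζ
  have h : (ζ : F) ^ 2 + ζ + 1 = 0 :=
    mul_left_cancel₀ (sub_ne_zero.mpr h1) (by linear_combination h3)
  exact ⟨2 * ζ + 1, by linear_combination -4 * h⟩

lemma pow_mod_three_eq_one {p r : ℕ} (hp : p.Prime) (hp3 : 3 < p)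
    (hcase : Even r ∨ p % 3 = 1) : p ^ r % 3 = 1 := by
  have h0 : p % 3 ≠ 0 := fun h => by
    have := (Nat.prime_dvd_prime_iff_eq Nat.prime_three hp).mp (Nat.dvd_of_mod_eq_zero h)
    omega
  rcases hcase with ⟨s, rfl⟩ | h
  · have h2 : p ^ 2 % 3 = 1 := by
      have : p % 3 = 1 ∨ p % 3 = 2 := by omega
      rcases this with h | h <;> simp [Nat.pow_mod, h]
    rw [← two_mul, pow_mul, Nat.pow_mod, h2, one_pow, Nat.one_mod]
  · rw [Nat.pow_mod, h, one_pow, Nat.one_mod]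

end

/-- Let `q = p^r`, `p > 3` prime, `q > 9887`, and `E/F_q` elliptic with
`j(E) = 0` and an even number of rational points. If `r` is even or `p ≡ 1 (mod 3)`, then
the `3`-elliptic and the `6`-elliptic codes associated to `E` are non-extendable. -/
theorem statement15 (p r : ℕ) (hp : p.Prime) (hp3 : 3 < p)
    (hcard : Fintype.card F = p ^ r) (hq : 9887 < Fintype.card F)
    (W : WeierstrassCurve F) [W.IsElliptic] (hj : W.j = 0)
    (heven : Even (Nat.card W.toAffine.Point))
    (hcase : Even r ∨ p % 3 = 1) {n : ℕ}
    (hn : n = Nat.card W.toAffine.Point) (e : Fin n ≃ W.toAffine.Point) :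
    ¬ IsHExtendable 1 (ellipticCode W 3 e) ∧ ¬ IsHExtendable 1 (ellipticCode W 6 e) := by
  have h2 : (2 : F) ≠ 0 := mod_cast natCast_ne_zero_of_coprime hcard
    ((Nat.coprime_primes Nat.prime_two hp).mpr (by omega))
  have h3 : (3 : F) ≠ 0 := mod_cast natCast_ne_zero_of_coprime hcard
    ((Nat.coprime_primes Nat.prime_three hp).mpr (by omega))
  have hchar : ringChar F ≠ 2 := fun h => h2 (by
    have := ringChar.Nat.cast_ringChar (R := F)
    rw [h] at this
    exact_mod_cast this)
  have hm3 : IsSquare (-3 : F) := isSquare_neg_three (by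
    rw [hcard]
    exact pow_mod_three_eq_one hp hp3 hcase)
  obtain ⟨b, c, d, f, hb, h₁, h₂, h₃, h₄, h₆⟩ := exists_short_coeffs W hj h2 h3
  have hA := card_affPts_ge hchar hq hb
  have hθ := shortPoint_injective W c d f
  have himg := mem_curvePts_iff_exists_shortPoint W h₁ h₂ h₃ h₄ h₆
  have hn6 : 6 < n := by
    have hle : (curvePts b).card ≤ n := by
      rw [← Fintype.card_fin n, ← Finset.card_univ]
      refine Finset.card_le_card_of_surjOn (fun j => shortPoint W c d f (e j)) fun P hP => ?_
      obtain ⟨Q, rfl⟩ := (himg P).mp hP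
      exact ⟨e.symm Q, by simp, by simp⟩
    rw [curvePts, Finset.card_insertNone] at hle
    omega
  constructor
  · exact not_isHExtendable_ellipticCode e (by omega) hθ himg planeVec
      (lineChange c d (c * d - f)) (by rw [det_lineChange]; exact isUnit_one)
      (phiVec_three W c d f) (fun _ ha => card_lineZeros_le ha)
      (exists_three_le_card_lineZeros h2 h3 hm3 hb hA)
  · exact not_isHExtendable_ellipticCode e hn6 hθ himg conicVec
      (conicChange c d (c * d - f)) (by rw [det_conicChange]; exact isUnit_one)
      (phiVec_six W c d f) (fun _ ha => card_conicZeros_le ha)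
      (exists_six_le_card_conicZeros h2 h3 hm3 hb hA)

end NMDS
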